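/- arXiv:math/0012035 — 2 statements merged into one kernel-verified Lean document; each statement's English description precedes it below -/
import Mathlib

section
/- The set 𝒟 = {X ∈ sp(2n,ℝ) : the centralizer {S ∈ Sp(2n,ℝ) : SX = XS} is compact} of strongly stable elements is an open subset of sp(2n,ℝ). -/
open Matrix

/-- The standard symplectic form matrix `Ω = [[0, Iₙ], [-Iₙ, 0]]` on `ℝ²ⁿ`
(coordinates indexed by `Fin n ⊕ Fin n`). -/
noncomputable def Omega (n : ℕ) : Matrix (Fin n ⊕ Fin n) (Fin n ⊕ Fin n) ℝ :=
  Matrix.fromBlocks 0 1 (-1) 0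

/-- The real symplectic group `Sp(2n, ℝ) = {S : Sᵀ Ω S = Ω}`. -/
noncomputable def Sp (n : ℕ) : Set (Matrix (Fin n ⊕ Fin n) (Fin n ⊕ Fin n) ℝ) :=
  {S | Sᵀ * Omega n * S = Omega n}

/-- The symplectic Lie algebra `sp(2n, ℝ) = {X : Xᵀ Ω + Ω X = 0}`. -/
noncomputable def sp (n : ℕ) : Set (Matrix (Fin n ⊕ Fin n) (Fin n ⊕ Fin n) ℝ) :=
  {X | Xᵀ * Omega n + Omega n * X = 0}

open Filter Topology

section Compactness

variable {ι : Type*} [Fintype ι]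

lemma isCompact_matrix_box {ι : Type*} (R : ℝ) :
    IsCompact {M : Matrix ι ι ℝ | ∀ i j, M i j ∈ Set.Icc (-R) R} := by
  have h := isCompact_univ_pi (X := fun _ : ι => ι → ℝ)
    (s := fun _ => Set.univ.pi fun _ => Set.Icc (-R) R)
    fun _ => isCompact_univ_pi fun _ => isCompact_Icc
  have e : {M : Matrix ι ι ℝ | ∀ i j, M i j ∈ Set.Icc (-R) R} =
      Set.univ.pi fun _ : ι => Set.univ.pi fun _ : ι => Set.Icc (-R) R := by
    ext M
    exact ⟨fun hM i _ j _ => hM i j, fun hM i j => hM i trivial j trivial⟩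
  rw [e]
  exact h

lemma IsCompact.exists_entry_bound {K : Set (Matrix ι ι ℝ)} (hK : IsCompact K) :
    ∃ R : ℝ, ∀ M ∈ K, ∀ i j, M i j ∈ Set.Icc (-R) R := by
  have h (p : ι × ι) : ∃ r, ∀ M ∈ K, ‖M p.1 p.2‖ ≤ r :=
    hK.exists_bound_of_continuousOn (continuous_id.matrix_elem p.1 p.2).continuousOn
  choose r hr using h
  refine ⟨∑ p, |r p|, fun M hM i j => abs_le.mp ?_⟩
  calc |M i j| ≤ r (i, j) := hr (i, j) M hM
    _ ≤ |r (i, j)| := le_abs_self _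
    _ ≤ ∑ p, |r p| := Finset.single_le_sum (fun p _ => abs_nonneg (r p)) (Finset.mem_univ _)

lemma isCompact_dotProduct_self_eq_one : IsCompact {u : ι → ℝ | u ⬝ᵥ u = 1} := by
  have hbox : IsCompact (Set.univ.pi fun _ : ι => Set.Icc (-1 : ℝ) 1) :=
    isCompact_univ_pi fun _ => isCompact_Icc
  refine hbox.of_isClosed_subset (isClosed_eq (by fun_prop) continuous_const) fun u hu i _ => ?_
  have h1 : u i * u i ≤ u ⬝ᵥ u :=
    Finset.single_le_sum (f := fun k => u k * u k) (fun k _ => mul_self_nonneg _)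
      (Finset.mem_univ i)
  rw [Set.mem_ofPred_eq.mp hu] at h1
  exact abs_le.mp (abs_le_one_iff_mul_self_le_one.mpr h1)

lemma mul_dotProduct_self_le {M : Matrix ι ι ℝ} {c : ℝ}
    (h : ∀ u : ι → ℝ, u ⬝ᵥ u = 1 → c ≤ u ⬝ᵥ M *ᵥ u) (u : ι → ℝ) :
    c * (u ⬝ᵥ u) ≤ u ⬝ᵥ M *ᵥ u := by
  rcases eq_or_ne u 0 with rfl | hu
  · simp
  have hpos : 0 < u ⬝ᵥ u := by simpa using dotProduct_star_self_pos_iff.mpr hu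
  have hs := Real.sq_sqrt hpos.le
  have hr : Real.sqrt (u ⬝ᵥ u) ≠ 0 := (Real.sqrt_pos.mpr hpos).ne'
  have hi : (Real.sqrt (u ⬝ᵥ u))⁻¹ * (Real.sqrt (u ⬝ᵥ u))⁻¹ = (u ⬝ᵥ u)⁻¹ := by
    rw [← mul_inv, Real.mul_self_sqrt hpos.le]
  have := h ((Real.sqrt (u ⬝ᵥ u))⁻¹ • u) (by
    rw [smul_dotProduct, dotProduct_smul, smul_eq_mul, smul_eq_mul, ← mul_assoc, hi,
      inv_mul_cancel₀ hpos.ne'])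
  rw [mulVec_smul, smul_dotProduct, dotProduct_smul, smul_eq_mul, smul_eq_mul, ← mul_assoc, hi,
    inv_mul_eq_div, le_div_iff₀ hpos] at this
  exact this

lemma exists_pos_mul_dotProduct_self_le {M : Matrix ι ι ℝ}
    (h : ∀ u : ι → ℝ, u ⬝ᵥ u = 1 → 0 < u ⬝ᵥ M *ᵥ u) :
    ∃ c > 0, ∀ u : ι → ℝ, c * (u ⬝ᵥ u) ≤ u ⬝ᵥ M *ᵥ u := by
  obtain ⟨c, hc, hcu⟩ := isCompact_dotProduct_self_eq_one.exists_forall_le'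
    (f := fun u : ι → ℝ => u ⬝ᵥ M *ᵥ u) (by fun_prop) h
  exact ⟨c, hc, mul_dotProduct_self_le hcu⟩

/-- A closed set of isometries of a positive definite bilinear form is compact. -/
lemma isCompact_of_isometries [DecidableEq ι] {M : Matrix ι ι ℝ}
    (h : ∀ u : ι → ℝ, u ⬝ᵥ u = 1 → 0 < u ⬝ᵥ M *ᵥ u) {K : Set (Matrix ι ι ℝ)}
    (hK : IsClosed K) (hKM : ∀ S ∈ K, Sᵀ * M * S = M) : IsCompact K := by
  obtain ⟨c, hc, hcu⟩ := exists_pos_mul_dotProduct_self_le h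
  refine (isCompact_matrix_box (1 + ∑ k, |M k k| / c)).of_isClosed_subset hK
    fun S hS i j => abs_le.mp ?_
  have h1 : S i j * S i j ≤ (S *ᵥ Pi.single j 1) ⬝ᵥ (S *ᵥ Pi.single j 1) := by
    rw [mulVec_single_one]
    exact Finset.single_le_sum (f := fun k => S k j * S k j) (fun k _ => mul_self_nonneg _)
      (Finset.mem_univ i)
  have h2 : (S *ᵥ Pi.single j 1) ⬝ᵥ M *ᵥ (S *ᵥ Pi.single j 1) = M j j := by
    rw [dotProduct_comm, ← dotProduct_transpose_mulVec, mulVec_mulVec, mulVec_mulVec, hKM S hS]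
    simp
  have h3 := hcu (S *ᵥ Pi.single j 1)
  rw [h2] at h3
  have h4 : S i j * S i j ≤ |M j j| / c := by
    rw [le_div_iff₀ hc]
    nlinarith [le_abs_self (M j j)]
  have h5 : |M j j| / c ≤ ∑ k, |M k k| / c :=
    Finset.single_le_sum (f := fun k => |M k k| / c) (fun k _ => by positivity)
      (Finset.mem_univ j)
  nlinarith [abs_mul_abs_self (S i j), abs_nonneg (S i j)]

end Compactness

section Diagonalization

variable {ι : Type*} [Fintype ι]

open scoped MatrixOrder in
/-- A matrix that is self-adjoint for a positive definite form is diagonalizable. -/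
lemma Matrix.PosDef.exists_eigenvectors [DecidableEq ι] {P A : Matrix ι ι ℝ} (hP : P.PosDef)
    (hA : P * A = Aᵀ * P) :
    ∃ (e : ι → ι → ℝ) (d : ι → ℝ), (∀ j, A *ᵥ e j = d j • e j) ∧
      ∀ u : ι → ℝ, ∃ c : ι → ℝ, u = ∑ j, c j • e j := by
  obtain ⟨B, hB⟩ := CStarAlgebra.nonneg_iff_eq_star_mul_self.mp hP.posSemidef.nonneg
  rw [star_eq_conjTranspose, conjTranspose_eq_transpose_of_trivial] at hB
  have hdet : IsUnit B.det := by
    have h := (Matrix.isUnit_iff_isUnit_det _).mp hP.isUnit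
    rw [hB, det_mul] at h
    exact isUnit_of_mul_isUnit_right h
  have hdetT : IsUnit Bᵀ.det := by rwa [det_transpose]
  have hH : (B * A * B⁻¹).IsHermitian := by
    rw [IsHermitian, conjTranspose_eq_transpose_of_trivial, transpose_mul, transpose_mul,
      transpose_nonsing_inv]
    calc Bᵀ⁻¹ * (Aᵀ * Bᵀ) = Bᵀ⁻¹ * (Aᵀ * (Bᵀ * B)) * B⁻¹ := by
          simp only [Matrix.mul_assoc, mul_nonsing_inv _ hdet, Matrix.mul_one]
      _ = (Bᵀ⁻¹ * Bᵀ) * (B * A * B⁻¹) := by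
          rw [← hB, ← hA, hB]
          simp only [Matrix.mul_assoc]
      _ = B * A * B⁻¹ := by rw [nonsing_inv_mul _ hdetT, Matrix.one_mul]
  refine ⟨fun j => B⁻¹ *ᵥ ⇑(hH.eigenvectorBasis j), hH.eigenvalues, fun j => ?_, fun u =>
    ⟨fun j => hH.eigenvectorBasis.repr (WithLp.toLp 2 (B *ᵥ u)) j, ?_⟩⟩
  · rw [← mulVec_smul, ← hH.mulVec_eigenvectorBasis j, mulVec_mulVec, mulVec_mulVec,
      ← Matrix.mul_assoc, ← Matrix.mul_assoc, nonsing_inv_mul _ hdet, Matrix.one_mul]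
  · have h := congrArg WithLp.ofLp
      (hH.eigenvectorBasis.sum_repr (WithLp.toLp 2 (B *ᵥ u)))
    rw [WithLp.ofLp_sum] at h
    simp only [WithLp.ofLp_smul] at h
    simp only [← mulVec_smul]
    rw [← mulVec_sum, h, mulVec_mulVec, nonsing_inv_mul _ hdet, one_mulVec]

lemma aeval_mulVec_of_eigenvector [DecidableEq ι] {A : Matrix ι ι ℝ} {x : ι → ℝ} {a : ℝ}
    (h : A *ᵥ x = a • x) (q : Polynomial ℝ) :
    Polynomial.aeval A q *ᵥ x = q.eval a • x := by
  induction q using Polynomial.induction_on' with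
  | add p q hp hq => simp [add_mulVec, add_smul, hp, hq]
  | monomial n b =>
    have hn : ∀ n : ℕ, (A ^ n) *ᵥ x = a ^ n • x := by
      intro n
      induction n with
      | zero => simp
      | succ n ih => rw [pow_succ, ← mulVec_mulVec, h, mulVec_smul, ih, smul_smul, pow_succ']
    rw [Polynomial.aeval_monomial, ← Algebra.smul_def, smul_mulVec, hn, Polynomial.eval_monomial,
      smul_smul]

end Diagonalization

section QuadraticForms

variable {ι : Type*} [Fintype ι]

lemma dotProduct_mulVec_self_eq_zero {J : Matrix ι ι ℝ} (hJt : Jᵀ = -J) (x : ι → ℝ) :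
    x ⬝ᵥ J *ᵥ x = 0 := by
  have h := dotProduct_transpose_mulVec J x x
  rw [hJt, neg_mulVec, dotProduct_neg] at h
  linarith

/-- A quadratic form that is anisotropic on a subspace is definite on it. -/
lemma Submodule.exists_sign_of_anisotropic {M : Matrix ι ι ℝ} (E : Submodule ℝ (ι → ℝ))
    (hM : ∀ x ∈ E, x ⬝ᵥ M *ᵥ x = 0 → x = 0) :
    ∃ s : ℝ, ∀ x ∈ E, x ≠ 0 → 0 < s * (x ⬝ᵥ M *ᵥ x) := by
  by_cases hex : ∃ x ∈ E, 0 < x ⬝ᵥ M *ᵥ x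
  · obtain ⟨x, hxE, hx⟩ := hex
    refine ⟨1, fun y hyE hy => ?_⟩
    rw [one_mul]
    by_contra! hle
    have hcont : Continuous fun t : ℝ =>
        ((1 - t) • x + t • y) ⬝ᵥ M *ᵥ ((1 - t) • x + t • y) := by fun_prop
    obtain ⟨t, -, ht⟩ := intermediate_value_Icc' (zero_le_one' ℝ) hcont.continuousOn
      (show (0 : ℝ) ∈ Set.Icc _ _ by simpa using ⟨hle, hx.le⟩)
    have hz := hM _ (E.add_mem (E.smul_mem (1 - t) hxE) (E.smul_mem t hyE)) ht
    have hlt : y ⬝ᵥ M *ᵥ y < 0 := lt_of_le_of_ne hle fun h => hy (hM y hyE h)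
    have hxy : (1 - t) • x = -(t • y) := eq_neg_of_add_eq_zero_left hz
    have hq : (1 - t) * ((1 - t) * (x ⬝ᵥ M *ᵥ x)) = t * (t * (y ⬝ᵥ M *ᵥ y)) := by
      have := congrArg (fun v => v ⬝ᵥ M *ᵥ v) hxy
      simpa [mulVec_smul, mulVec_neg] using this
    have h1 : 0 ≤ (1 - t) ^ 2 * (x ⬝ᵥ M *ᵥ x) := by positivity
    have h2 : 0 ≤ t ^ 2 * -(y ⬝ᵥ M *ᵥ y) := mul_nonneg (sq_nonneg t) (by linarith)
    have h3 : (1 - t) ^ 2 = 0 :=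
      (mul_eq_zero.mp (by nlinarith : (1 - t) ^ 2 * (x ⬝ᵥ M *ᵥ x) = 0)).resolve_right hx.ne'
    have h4 : t ^ 2 = 0 :=
      (mul_eq_zero.mp (by nlinarith : t ^ 2 * -(y ⬝ᵥ M *ᵥ y) = 0)).resolve_right
        (by linarith)
    nlinarith
  · push Not at hex
    refine ⟨-1, fun x hxE hx => ?_⟩
    have := lt_of_le_of_ne (hex x hxE) fun h => hx (hM x hxE h)
    linarith

end QuadraticForms

section Averaging

variable {ι : Type*} [Fintype ι] [DecidableEq ι]

/-- A matrix whose powers stay in a compact set of invertible matrices preserves some positive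
definite form, obtained as a limit of Cesàro means. -/
lemma exists_posDef_invariant_of_pow_mem {K : Set (Matrix ι ι ℝ)} (hK : IsCompact K)
    (hinj : ∀ T ∈ K, ∀ u : ι → ℝ, T *ᵥ u = 0 → u = 0) {S : Matrix ι ι ℝ} (hS : ∀ j : ℕ, S ^ j ∈ K) :
    ∃ P : Matrix ι ι ℝ, P.PosDef ∧ Sᵀ * P * S = P := by
  obtain ⟨R, hR⟩ := (hK.image (f := fun T : Matrix ι ι ℝ => Tᵀ * T)
    (by fun_prop)).exists_entry_bound
  have hR' (k : ℕ) (a b : ι) : ((S ^ k)ᵀ * S ^ k) a b ∈ Set.Icc (-R) R :=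
    hR _ ⟨S ^ k, hS k, rfl⟩ a b
  obtain ⟨c, hc, hcK⟩ := (hK.prod (isCompact_dotProduct_self_eq_one (ι := ι))).exists_forall_le'
    (f := fun p : Matrix ι ι ℝ × (ι → ℝ) => (p.1 *ᵥ p.2) ⬝ᵥ (p.1 *ᵥ p.2))
    (by fun_prop) (a := 0) (by
      rintro ⟨T, u⟩ ⟨hT, hu⟩
      have hne : T *ᵥ u ≠ 0 := fun h0 => by
        have h1 : u ⬝ᵥ u = 1 := hu
        rw [hinj T hT u h0] at h1
        simp at h1
      simpa using dotProduct_star_self_pos_iff.mpr hne)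
  set mean : ℕ → Matrix ι ι ℝ := fun k =>
    ((k : ℝ) + 1)⁻¹ • ∑ j ∈ Finset.range (k + 1), (S ^ j)ᵀ * S ^ j with hmean
  have hpos (k : ℕ) : (0 : ℝ) < (k : ℝ) + 1 := by positivity
  have hbox (k : ℕ) (a b : ι) : mean k a b ∈ Set.Icc (-R) R := by
    have e : mean k a b = (∑ j ∈ Finset.range (k + 1), ((S ^ j)ᵀ * S ^ j) a b) / ((k : ℝ) + 1) := by
      simp only [hmean, Matrix.smul_apply, Matrix.sum_apply, smul_eq_mul]
      rw [inv_mul_eq_div]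
    have h1 := Finset.sum_le_card_nsmul (Finset.range (k + 1))
      (fun j => ((S ^ j)ᵀ * S ^ j) a b) R fun j _ => (hR' j a b).2
    have h2 := Finset.card_nsmul_le_sum (Finset.range (k + 1))
      (fun j => ((S ^ j)ᵀ * S ^ j) a b) (-R) fun j _ => (hR' j a b).1
    simp only [Finset.card_range, nsmul_eq_mul, Nat.cast_add, Nat.cast_one] at h1 h2
    rw [e]
    exact ⟨by rw [le_div_iff₀ (hpos k)]; linarith, by rw [div_le_iff₀ (hpos k)]; linarith⟩
  obtain ⟨P, -, hP⟩ := (isCompact_matrix_box (ι := ι) R).ultrafilter_le_nhds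
    ((hyperfilter ℕ).map mean) (by
      rw [le_principal_iff]
      exact Filter.mem_map.mpr (Filter.univ_mem' hbox))
  have hlim : Tendsto mean (hyperfilter ℕ : Filter ℕ) (𝓝 P) := hP
  have hsymm : P.IsHermitian := by
    refine (isClosed_eq (f := fun M : Matrix ι ι ℝ => Mᴴ) (g := id) (by fun_prop)
      continuous_id).mem_of_tendsto hlim (Eventually.of_forall fun k => ?_)
    simp [hmean, conjTranspose_eq_transpose_of_trivial, transpose_sum, transpose_mul]
  have hlower (u : ι → ℝ) (hu : u ⬝ᵥ u = 1) : c ≤ u ⬝ᵥ P *ᵥ u := by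
    refine ge_of_tendsto (((by fun_prop : Continuous fun M : Matrix ι ι ℝ =>
      u ⬝ᵥ M *ᵥ u).tendsto P).comp hlim) (Eventually.of_forall fun k => ?_)
    have e : u ⬝ᵥ mean k *ᵥ u =
        (∑ j ∈ Finset.range (k + 1), ((S ^ j) *ᵥ u) ⬝ᵥ ((S ^ j) *ᵥ u)) / ((k : ℝ) + 1) := by
      simp only [hmean, smul_mulVec, dotProduct_smul, sum_mulVec, dotProduct_sum, smul_eq_mul]
      rw [inv_mul_eq_div]
      congr 1
      refine Finset.sum_congr rfl fun j _ => ?_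
      rw [← mulVec_mulVec, dotProduct_transpose_mulVec]
    have h := Finset.card_nsmul_le_sum (Finset.range (k + 1))
      (fun j => ((S ^ j) *ᵥ u) ⬝ᵥ ((S ^ j) *ᵥ u)) c fun j _ => hcK (S ^ j, u) ⟨hS j, hu⟩
    simp only [Finset.card_range, nsmul_eq_mul, Nat.cast_add, Nat.cast_one] at h
    simp only [Function.comp_apply]
    rw [e, le_div_iff₀ (hpos k)]
    linarith
  refine ⟨P, PosDef.of_dotProduct_mulVec_pos hsymm fun u hu => ?_, ?_⟩
  · have h1 : 0 < u ⬝ᵥ u := by simpa using dotProduct_star_self_pos_iff.mpr hu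
    rw [star_trivial]
    exact (mul_pos hc h1).trans_le (mul_dotProduct_self_le hlower u)
  · have htele (k : ℕ) : Sᵀ * mean k * S - mean k =
        ((k : ℝ) + 1)⁻¹ • ((S ^ (k + 1))ᵀ * S ^ (k + 1) - (S ^ 0)ᵀ * S ^ 0) := by
      rw [← Finset.sum_range_sub (fun j => (S ^ j)ᵀ * S ^ j), Finset.sum_sub_distrib, smul_sub]
      simp only [hmean, Matrix.mul_smul, Matrix.smul_mul, Finset.mul_sum, Finset.sum_mul]
      congr 2
      refine Finset.sum_congr rfl fun j _ => ?_
      rw [pow_succ, transpose_mul]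
      simp only [Matrix.mul_assoc]
    rw [← sub_eq_zero]
    ext a b
    have hentry : Tendsto (fun k => (Sᵀ * mean k * S - mean k) a b) (hyperfilter ℕ : Filter ℕ)
        (𝓝 ((Sᵀ * P * S - P) a b)) :=
      ((by fun_prop : Continuous fun M : Matrix ι ι ℝ =>
        (Sᵀ * M * S - M) a b).tendsto P).comp hlim
    have hinv : Tendsto (fun k : ℕ => ((k : ℝ) + 1)⁻¹ * (2 * R)) (hyperfilter ℕ : Filter ℕ)
        (𝓝 0) := by
      have := (tendsto_one_div_add_atTop_nhds_zero_nat (𝕜 := ℝ)).mul_const (2 * R)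
      simp only [one_div, zero_mul] at this
      exact this.mono_left Nat.hyperfilter_le_atTop
    refine tendsto_nhds_unique hentry (squeeze_zero_norm (fun k => ?_) hinv)
    rw [htele, Matrix.smul_apply, smul_eq_mul, norm_mul,
      Real.norm_of_nonneg (inv_pos.mpr (hpos k)).le,
      Matrix.sub_apply, Real.norm_eq_abs]
    refine mul_le_mul_of_nonneg_left ?_ (inv_pos.mpr (hpos k)).le
    have h1 := hR' (k + 1) a b
    have h2 := hR' 0 a b
    exact abs_le.mpr ⟨by linarith [h1.1, h2.2], by linarith [h1.2, h2.1]⟩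

end Averaging

section Symplectic

variable {ι : Type*} [Fintype ι]

/-- The centralizer of `X` in the isometry group of the bilinear form with matrix `J`. -/
def isometryCentralizer (J X : Matrix ι ι ℝ) : Set (Matrix ι ι ℝ) :=
  {S | Sᵀ * J * S = J ∧ S * X = X * S}

lemma isClosed_isometryCentralizer (J X : Matrix ι ι ℝ) :
    IsClosed (isometryCentralizer J X) :=
  (isClosed_eq (by fun_prop) continuous_const).inter (isClosed_eq (by fun_prop) (by fun_prop))

variable [DecidableEq ι] {J X : Matrix ι ι ℝ}

lemma pow_mem_isometryCentralizer {S : Matrix ι ι ℝ} (hS : S ∈ isometryCentralizer J X) (k : ℕ) :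
    S ^ k ∈ isometryCentralizer J X := by
  refine ⟨?_, (Commute.pow_left (show Commute S X from hS.2) k)⟩
  induction k with
  | zero => simp
  | succ k ih =>
    rw [pow_succ, transpose_mul]
    calc Sᵀ * (S ^ k)ᵀ * J * (S ^ k * S) = Sᵀ * ((S ^ k)ᵀ * J * S ^ k) * S := by
          simp only [Matrix.mul_assoc]
      _ = J := by rw [ih, hS.1]

lemma eq_zero_of_isometry_mulVec_eq_zero (hJ : J * J = -1) {S : Matrix ι ι ℝ}
    (hS : Sᵀ * J * S = J) {u : ι → ℝ} (hu : S *ᵥ u = 0) : u = 0 := by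
  have h : J *ᵥ u = 0 := by rw [← hS, ← mulVec_mulVec, hu, mulVec_zero]
  have h2 : (J * J) *ᵥ u = 0 := by rw [← mulVec_mulVec, h, mulVec_zero]
  simpa [hJ, neg_mulVec] using h2

/-- A nonzero multiple of an infinitesimal isometry has a Cayley transform. -/
lemma exists_cayley (hX : Xᵀ * J + J * X = 0) :
    ∃ t : ℝ, t ≠ 0 ∧ ∃ S ∈ isometryCentralizer J X, S * (1 - t • X) = 1 + t • X := by
  have hcont : Continuous fun t : ℝ => (1 - t • X).det := by fun_prop
  have hev : ∀ᶠ t in 𝓝[≠] (0 : ℝ), (1 - t • X).det ≠ 0 :=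
    nhdsWithin_le_nhds (hcont.continuousAt.eventually_ne (by simp))
  obtain ⟨t, hdet, ht⟩ := (hev.and self_mem_nhdsWithin).exists
  have hu : IsUnit (1 - t • X).det := isUnit_iff_ne_zero.mpr hdet
  have huT : IsUnit (1 - t • X)ᵀ.det := by rwa [det_transpose]
  have hXJ : Xᵀ * J = -(J * X) := eq_neg_of_add_eq_zero_left hX
  have hN : (1 - t • X)ᵀ * J = J * (1 + t • X) := by
    simp [transpose_sub, sub_mul, mul_add, hXJ]
  have hM : (1 + t • X)ᵀ * J = J * (1 - t • X) := by
    simp [transpose_add, add_mul, mul_add, hXJ, sub_eq_add_neg]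
  have hcomm : (1 - t • X) * (1 + t • X) = (1 + t • X) * (1 - t • X) :=
    (Commute.one_left _).sub_left ((Commute.one_right _).add_right (Commute.refl _))
  have hcX : (1 - t • X) * X = X * (1 - t • X) := by simp [sub_mul, mul_sub]
  have hcX' : (1 + t • X) * X = X * (1 + t • X) := by simp [add_mul, mul_add]
  refine ⟨t, ht, (1 + t • X) * (1 - t • X)⁻¹, ⟨?_, ?_⟩, ?_⟩
  · rw [transpose_mul, transpose_nonsing_inv]
    calc (1 - t • X)ᵀ⁻¹ * (1 + t • X)ᵀ * J * ((1 + t • X) * (1 - t • X)⁻¹)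
        = (1 - t • X)ᵀ⁻¹ * ((1 + t • X)ᵀ * J) * (1 + t • X) * (1 - t • X)⁻¹ := by
          simp only [Matrix.mul_assoc]
      _ = (1 - t • X)ᵀ⁻¹ * (J * ((1 - t • X) * (1 + t • X))) * (1 - t • X)⁻¹ := by
          rw [hM]
          simp only [Matrix.mul_assoc]
      _ = (1 - t • X)ᵀ⁻¹ * (J * (1 + t • X)) * ((1 - t • X) * (1 - t • X)⁻¹) := by
          rw [hcomm]
          simp only [Matrix.mul_assoc]
      _ = J := by
          rw [← hN, mul_nonsing_inv _ hu, Matrix.mul_one, ← Matrix.mul_assoc,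
            nonsing_inv_mul _ huT, Matrix.one_mul]
  · have h : (1 - t • X)⁻¹ * X = X * (1 - t • X)⁻¹ := by
      calc (1 - t • X)⁻¹ * X = (1 - t • X)⁻¹ * (X * (1 - t • X)) * (1 - t • X)⁻¹ := by
            simp only [Matrix.mul_assoc, mul_nonsing_inv _ hu, Matrix.mul_one]
        _ = X * (1 - t • X)⁻¹ := by
            rw [← hcX, ← Matrix.mul_assoc, nonsing_inv_mul _ hu, Matrix.one_mul]
    rw [Matrix.mul_assoc, h, ← Matrix.mul_assoc, hcX', Matrix.mul_assoc]
  · rw [Matrix.mul_assoc, nonsing_inv_mul _ hu, Matrix.mul_one]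

lemma exists_posDef_skew (hJ : J * J = -1) (hX : Xᵀ * J + J * X = 0)
    (hK : IsCompact (isometryCentralizer J X)) :
    ∃ P : Matrix ι ι ℝ, P.PosDef ∧ Xᵀ * P = -(P * X) := by
  obtain ⟨t, ht, S, hS, hSX⟩ := exists_cayley hX
  obtain ⟨P, hP, hSP⟩ := exists_posDef_invariant_of_pow_mem hK
    (fun T hT u hu => eq_zero_of_isometry_mulVec_eq_zero hJ hT.1 hu)
    (fun k => pow_mem_isometryCentralizer hS k)
  refine ⟨P, hP, ?_⟩
  have h : (1 + t • X)ᵀ * P * (1 + t • X) = (1 - t • X)ᵀ * P * (1 - t • X) := by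
    rw [← hSX, transpose_mul]
    calc (1 - t • X)ᵀ * Sᵀ * P * (S * (1 - t • X))
        = (1 - t • X)ᵀ * (Sᵀ * P * S) * (1 - t • X) := by simp only [Matrix.mul_assoc]
      _ = _ := by rw [hSP]
  have h2 : (2 * t) • (Xᵀ * P + P * X) = 0 := by
    have e : (2 * t) • (Xᵀ * P + P * X) =
        (1 + t • X)ᵀ * P * (1 + t • X) - (1 - t • X)ᵀ * P * (1 - t • X) := by
      simp only [transpose_add, transpose_sub, transpose_one, transpose_smul, add_mul, sub_mul,
        mul_add, mul_sub, Matrix.one_mul, Matrix.mul_one, Matrix.smul_mul, Matrix.mul_smul]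
      module
    rw [e, h, sub_self]
  exact eq_neg_of_add_eq_zero_left ((smul_eq_zero.mp h2).resolve_left (by positivity))

end Symplectic

section StrongStability

variable {ι : Type*} [Fintype ι] [DecidableEq ι] {J X : Matrix ι ι ℝ}

/-- If `Q` is symmetric with `X Q` skew and `Q J Q = 0`, the centralizer of `X` contains the
unbounded one-parameter group `1 + t Q J`, unless `Q = 0`. -/
lemma eq_zero_of_isCompact_isometryCentralizer (hJt : Jᵀ = -J) (hJ : J * J = -1)
    (hX : Xᵀ * J + J * X = 0) (hK : IsCompact (isometryCentralizer J X)) {Q : Matrix ι ι ℝ}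
    (hQ : Qᵀ = Q) (hXQ : X * Q = -(Q * Xᵀ)) (hQJQ : Q * J * Q = 0) : Q = 0 := by
  have hXJ : Xᵀ * J = -(J * X) := eq_neg_of_add_eq_zero_left hX
  have hcomm : Q * J * X = X * (Q * J) := by
    rw [← Matrix.mul_assoc X, hXQ, Matrix.neg_mul, Matrix.mul_assoc Q Xᵀ, hXJ, Matrix.mul_neg,
      neg_neg, Matrix.mul_assoc]
  have hmem (t : ℝ) : 1 + t • (Q * J) ∈ isometryCentralizer J X := by
    refine ⟨?_, by simp only [Matrix.add_mul, Matrix.mul_add, Matrix.smul_mul, Matrix.mul_smul,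
      hcomm, Matrix.one_mul, Matrix.mul_one]⟩
    have h0 : J * Q * J * (Q * J) = 0 := by
      rw [show J * Q * J * (Q * J) = J * (Q * J * Q) * J by simp only [Matrix.mul_assoc], hQJQ,
        Matrix.mul_zero, Matrix.zero_mul]
    simp only [transpose_add, transpose_one, transpose_smul, transpose_mul, hJt, hQ,
      Matrix.add_mul, Matrix.mul_add, Matrix.smul_mul, Matrix.mul_smul, Matrix.neg_mul, h0,
      Matrix.one_mul, Matrix.mul_one]
    simp [Matrix.mul_assoc]
  obtain ⟨R, hR⟩ := hK.exists_entry_bound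
  have hQJ : Q * J = 0 := by
    ext i j
    by_contra hne
    have hne' : (Q * J) i j ≠ 0 := hne
    have h := (hR _ (hmem ((R + 1 - (1 : Matrix ι ι ℝ) i j) / (Q * J) i j)) i j).2
    rw [Matrix.add_apply, Matrix.smul_apply, smul_eq_mul, div_mul_cancel₀ _ hne'] at h
    linarith
  have h : Q * (J * J) = 0 := by rw [← Matrix.mul_assoc, hQJ, Matrix.zero_mul]
  simpa [hJ] using h

/-- The form `x ↦ ⟨x, J X x⟩` is anisotropic on the eigenspaces of `-X²`. -/
lemma eq_zero_of_isotropic_eigenvector (hJt : Jᵀ = -J) (hJ : J * J = -1)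
    (hX : Xᵀ * J + J * X = 0) (hK : IsCompact (isometryCentralizer J X)) {x : ι → ℝ} {a : ℝ}
    (hx : (-(X * X)) *ᵥ x = a • x) (hiso : x ⬝ᵥ (J * X) *ᵥ x = 0) : x = 0 := by
  by_contra hx0
  obtain ⟨P, hP, hXP⟩ := exists_posDef_skew hJ hX hK
  set y := X *ᵥ x with hy
  have hXy : X *ᵥ y = -(a • x) := by
    rw [← hx, neg_mulVec, neg_neg, hy, mulVec_mulVec]
  have hyPy : y ⬝ᵥ P *ᵥ y = a * (x ⬝ᵥ P *ᵥ x) := by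
    calc y ⬝ᵥ P *ᵥ y = x ⬝ᵥ (Xᵀ * P) *ᵥ y := by
          rw [← mulVec_mulVec, dotProduct_transpose_mulVec, dotProduct_comm, hy]
      _ = a * (x ⬝ᵥ P *ᵥ x) := by
          rw [hXP, neg_mulVec, ← mulVec_mulVec, hXy, mulVec_neg, neg_neg, mulVec_smul,
            dotProduct_smul, smul_eq_mul]
  have hxP : 0 < x ⬝ᵥ P *ᵥ x := by simpa using hP.dotProduct_mulVec_pos hx0
  have hyP : 0 ≤ y ⬝ᵥ P *ᵥ y := by simpa using hP.posSemidef.dotProduct_mulVec_nonneg y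
  have ha : 0 ≤ a := nonneg_of_mul_nonneg_left (hyPy ▸ hyP) hxP
  have hay : (a⁻¹ * a) • y = y := by
    rcases eq_or_ne a 0 with h0 | h0
    · have hy0 : y = 0 := by
        by_contra hne
        have := hP.dotProduct_mulVec_pos hne
        rw [star_trivial, hyPy, h0, zero_mul] at this
        exact this.false
      rw [hy0, smul_zero]
    · rw [inv_mul_cancel₀ h0, one_smul]
  have hxJy : x ⬝ᵥ J *ᵥ y = 0 := by rwa [← mulVec_mulVec] at hiso
  have hyJx : y ⬝ᵥ J *ᵥ x = 0 := by
    rw [← dotProduct_transpose_mulVec, hJt, neg_mulVec, dotProduct_neg, hxJy, neg_zero]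
  have hXQ : X * (vecMulVec x x + a⁻¹ • vecMulVec y y) = vecMulVec y x - vecMulVec x y := by
    rw [Matrix.mul_add, Matrix.mul_smul, mul_vecMulVec, mul_vecMulVec, ← hy, hXy, neg_vecMulVec,
      smul_vecMulVec, smul_neg, smul_smul, ← vecMulVec_smul, hay, sub_eq_add_neg]
  have hQ : (vecMulVec x x + a⁻¹ • vecMulVec y y)ᵀ = vecMulVec x x + a⁻¹ • vecMulVec y y := by
    simp [transpose_vecMulVec]
  have h0 := eq_zero_of_isCompact_isometryCentralizer hJt hJ hX hK hQ (by
    conv_rhs => rw [← hQ, ← transpose_mul, hXQ]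
    rw [hXQ]
    simp [transpose_vecMulVec]) (by
    rw [Matrix.mul_assoc]
    simp [-mulVec_mulVec, Matrix.mul_add, mul_vecMulVec, add_mulVec, smul_mulVec,
      vecMulVec_mulVec, hxJy, hyJx, dotProduct_mulVec_self_eq_zero hJt])
  refine hx0 (funext fun i => ?_)
  have hi := congrFun (congrFun h0 i) i
  simp only [Matrix.add_apply, Matrix.smul_apply, vecMulVec_apply, smul_eq_mul,
    Matrix.zero_apply] at hi
  have h1 : 0 ≤ a⁻¹ * (y i * y i) := mul_nonneg (inv_nonneg.mpr ha) (mul_self_nonneg _)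
  exact mul_self_eq_zero.mp (le_antisymm (by linarith) (mul_self_nonneg _))

/-- If the centralizer of `X` is compact, some polynomial `q` makes the symmetric form
`J X q(-X²)` positive definite. -/
lemma exists_polynomial_pos (hJt : Jᵀ = -J) (hJ : J * J = -1) (hX : Xᵀ * J + J * X = 0)
    (hK : IsCompact (isometryCentralizer J X)) :
    ∃ q : Polynomial ℝ, ∀ u : ι → ℝ, u ≠ 0 →
      0 < u ⬝ᵥ (J * X * Polynomial.aeval (-(X * X)) q) *ᵥ u := by
  obtain ⟨P, hP, hXP⟩ := exists_posDef_skew hJ hX hK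
  have hXJ : Xᵀ * J = -(J * X) := eq_neg_of_add_eq_zero_left hX
  set A := -(X * X) with hA
  have hAP : P * A = Aᵀ * P := by
    rw [hA, transpose_neg, transpose_mul, Matrix.neg_mul, Matrix.mul_assoc, hXP, Matrix.mul_neg,
      Matrix.mul_neg, ← Matrix.mul_assoc Xᵀ, hXP]
    simp [Matrix.mul_assoc]
  have hAJ : Aᵀ * (J * X) = J * X * A := by
    rw [hA, transpose_neg, transpose_mul, ← Matrix.mul_assoc, Matrix.neg_mul,
      Matrix.mul_assoc Xᵀ Xᵀ J, hXJ, Matrix.mul_neg, ← Matrix.mul_assoc, hXJ]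
    simp [Matrix.mul_assoc]
  obtain ⟨e, d, he, hspan⟩ := hP.exists_eigenvectors hAP
  have hsign (a : ℝ) := (Module.End.eigenspace (toLin' A) a).exists_sign_of_anisotropic
    (M := J * X) fun x hx h => eq_zero_of_isotropic_eigenvector hJt hJ hX hK
      (by simpa [Module.End.mem_eigenspace_iff] using hx) h
  choose s hs using hsign
  obtain ⟨q, hq⟩ := (Polynomial.exists_eval_eq_iff d fun j => s (d j)).mpr
    fun i j hij => by rw [hij]
  refine ⟨q, fun u hu => ?_⟩
  obtain ⟨c, hc⟩ := hspan u
  set F := Finset.univ.image d with hF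
  set x : ℝ → ι → ℝ := fun a => ∑ j with d j = a, c j • e j with hxdef
  have hsum : u = ∑ a ∈ F, x a := by
    rw [hc, hxdef]
    exact (Finset.sum_fiberwise_of_maps_to (fun j _ => Finset.mem_image_of_mem d
      (Finset.mem_univ j)) _).symm
  have hxA (a : ℝ) : A *ᵥ x a = a • x a := by
    simp only [hxdef, mulVec_sum, Finset.smul_sum]
    refine Finset.sum_congr rfl fun j hj => ?_
    rw [mulVec_smul, he, (Finset.mem_filter.mp hj).2, smul_comm]
  have horth (a b : ℝ) (hab : a ≠ b) : x a ⬝ᵥ (J * X) *ᵥ x b = 0 := by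
    have h : a * (x a ⬝ᵥ (J * X) *ᵥ x b) = b * (x a ⬝ᵥ (J * X) *ᵥ x b) := by
      calc a * (x a ⬝ᵥ (J * X) *ᵥ x b) = (A *ᵥ x a) ⬝ᵥ (J * X) *ᵥ x b := by
            rw [hxA, smul_dotProduct, smul_eq_mul]
        _ = x a ⬝ᵥ (Aᵀ * (J * X)) *ᵥ x b := by
            rw [← mulVec_mulVec (v := x b) Aᵀ, dotProduct_transpose_mulVec, dotProduct_comm]
        _ = b * (x a ⬝ᵥ (J * X) *ᵥ x b) := by
            rw [hAJ, ← mulVec_mulVec (v := x b) (J * X), hxA, mulVec_smul, dotProduct_smul,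
              smul_eq_mul]
    exact (mul_eq_mul_right_iff.mp h).resolve_left hab
  have hval : u ⬝ᵥ (J * X * Polynomial.aeval A q) *ᵥ u =
      ∑ a ∈ F, s a * (x a ⬝ᵥ (J * X) *ᵥ x a) := by
    rw [hsum, sum_dotProduct]
    refine Finset.sum_congr rfl fun a ha => ?_
    rw [mulVec_sum, dotProduct_sum]
    have hterm (b : ℝ) : x a ⬝ᵥ (J * X * Polynomial.aeval A q) *ᵥ x b =
        q.eval b * (x a ⬝ᵥ (J * X) *ᵥ x b) := by
      rw [← mulVec_mulVec, aeval_mulVec_of_eigenvector (hxA b), mulVec_smul, dotProduct_smul,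
        smul_eq_mul]
    rw [Finset.sum_eq_single_of_mem a ha fun b _ hba => by
      rw [hterm, horth a b hba.symm, mul_zero], hterm]
    obtain ⟨j, -, rfl⟩ := Finset.mem_image.mp ha
    rw [hq]
  have hpos (a : ℝ) (h : x a ≠ 0) : 0 < s a * (x a ⬝ᵥ (J * X) *ᵥ x a) :=
    hs a (x a) (by simpa [Module.End.mem_eigenspace_iff] using hxA a) h
  rw [hval]
  refine Finset.sum_pos' (fun a _ => ?_) ?_
  · rcases eq_or_ne (x a) 0 with h | h
    · simp [h]
    · exact (hpos a h).le
  · by_contra! hle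
    refine hu (hsum.trans (Finset.sum_eq_zero fun a ha => ?_))
    by_contra h
    exact ((hpos a h).trans_le (hle a ha)).false

lemma isCompact_isometryCentralizer_of_pos {q : Polynomial ℝ}
    (h : ∀ u : ι → ℝ, u ⬝ᵥ u = 1 →
      0 < u ⬝ᵥ (J * X * Polynomial.aeval (-(X * X)) q) *ᵥ u) :
    IsCompact (isometryCentralizer J X) := by
  refine isCompact_of_isometries h (isClosed_isometryCentralizer J X) fun S hS => ?_
  have hSX : Commute S X := hS.2
  have hSq : Commute S (Polynomial.aeval (-(X * X)) q) := by
    rw [Polynomial.aeval_eq_sum_range]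
    exact Commute.sum_right _ _ _ fun k _ =>
      (((hSX.mul_right hSX).neg_right).pow_right k).smul_right _
  calc Sᵀ * (J * X * Polynomial.aeval (-(X * X)) q) * S
      = Sᵀ * J * (X * (Polynomial.aeval (-(X * X)) q * S)) := by simp only [Matrix.mul_assoc]
    _ = Sᵀ * J * S * X * Polynomial.aeval (-(X * X)) q := by
        rw [← hSq.eq, ← Matrix.mul_assoc X, ← hSX.eq]
        simp only [Matrix.mul_assoc]
    _ = J * X * Polynomial.aeval (-(X * X)) q := by rw [hS.1]

/-- Compactness of the centralizer is an open condition on infinitesimal isometries. -/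
lemma eventually_isCompact_isometryCentralizer (hJt : Jᵀ = -J) (hJ : J * J = -1)
    (hX : Xᵀ * J + J * X = 0) (hK : IsCompact (isometryCentralizer J X)) :
    ∀ᶠ Y in 𝓝 X, IsCompact (isometryCentralizer J Y) := by
  obtain ⟨q, hq⟩ := exists_polynomial_pos hJt hJ hX hK
  have hcont : Continuous fun p : Matrix ι ι ℝ × (ι → ℝ) =>
      p.2 ⬝ᵥ (J * p.1 * Polynomial.aeval (-(p.1 * p.1)) q) *ᵥ p.2 := by
    have : Continuous fun p : Matrix ι ι ℝ × (ι → ℝ) => Polynomial.aeval (-(p.1 * p.1)) q :=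
      q.continuous_aeval.comp (by fun_prop)
    fun_prop
  have hev := isCompact_dotProduct_self_eq_one.eventually_forall_of_forall_eventually
    (x₀ := X) (P := fun Y (u : ι → ℝ) =>
      0 < u ⬝ᵥ (J * Y * Polynomial.aeval (-(Y * Y)) q) *ᵥ u) fun u hu =>
    hcont.continuousAt.eventually_const_lt (hq u fun h0 => by
      have h1 : u ⬝ᵥ u = 1 := hu
      simp [h0] at h1)
  exact hev.mono fun Y hY => isCompact_isometryCentralizer_of_pos hY

end StrongStability

lemma transpose_Omega (n : ℕ) : (Omega n)ᵀ = -Omega n := by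
  simp [Omega, fromBlocks_transpose, fromBlocks_neg]

lemma Omega_mul_self (n : ℕ) : Omega n * Omega n = -1 := by
  rw [Omega, fromBlocks_multiply, ← fromBlocks_one, fromBlocks_neg]
  simp

/-- The set `𝒟` of strongly stable elements (those whose centralizer
in `Sp(2n,ℝ)` is compact) is an open subset of `sp(2n,ℝ)`. -/
theorem stronglyStable_isOpen (n : ℕ) :
    IsOpen {X : (sp n) |
      IsCompact {S ∈ Sp n | S * (X : Matrix (Fin n ⊕ Fin n) (Fin n ⊕ Fin n) ℝ)
        = (X : Matrix (Fin n ⊕ Fin n) (Fin n ⊕ Fin n) ℝ) * S}} := by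
  rw [isOpen_iff_mem_nhds]
  intro X hX
  exact continuous_subtype_val.continuousAt.eventually
    (eventually_isCompact_isometryCentralizer (transpose_Omega n) (Omega_mul_self n) X.2 hX)
end

section
/- In sp(2n,ℝ), the set 𝒟 = {X : the centralizer {S ∈ Sp(2n,ℝ) : SX = XS} is compact} of strongly stable elements is equal to the interior of the set of stable elements {X : ∃ S ∈ Sp(2n,ℝ), (S⁻¹XS)Ω = Ω(S⁻¹XS)}. In particular, a stable element is strongly stable if and only if it remains stable under all sufficiently small perturbations. -/
open Matrix

section InvariantForm

variable {ι : Type*} [Fintype ι]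

theorem posDef_real_iff {M : Matrix ι ι ℝ} :
    M.PosDef ↔ Mᵀ = M ∧ ∀ v : ι → ℝ, v ≠ 0 → 0 < v ⬝ᵥ M *ᵥ v := by
  rw [posDef_iff_dotProduct_mulVec, IsHermitian, conjTranspose_eq_transpose_of_trivial]
  simp

/-- A real matrix has an invariant form if it is skew with respect to some inner product. -/
def HasInvariantForm (X : Matrix ι ι ℝ) : Prop :=
  ∃ M : Matrix ι ι ℝ, M.PosDef ∧ Xᵀ * M + M * X = 0

theorem HasInvariantForm.smul {X : Matrix ι ι ℝ} (h : HasInvariantForm X) (a : ℝ) :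
    HasInvariantForm (a • X) := by
  obtain ⟨M, hM, hX⟩ := h
  refine ⟨M, hM, ?_⟩
  rw [transpose_smul, smul_mul, Matrix.mul_smul, ← smul_add, hX, smul_zero]

open Filter Topology in
theorem eventually_posDef {α : Type*} [TopologicalSpace α] {f : α → Matrix ι ι ℝ}
    (hf : Continuous f) (hs : ∀ x, (f x)ᵀ = f x) {x₀ : α} (h₀ : (f x₀).PosDef) :
    ∀ᶠ x in 𝓝 x₀, (f x).PosDef := by
  have hc : Continuous fun p : α × (ι → ℝ) => p.2 ⬝ᵥ f p.1 *ᵥ p.2 := by fun_prop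
  have h : ∀ᶠ x in 𝓝 x₀, ∀ v ∈ Metric.sphere (0 : ι → ℝ) 1, 0 < v ⬝ᵥ f x *ᵥ v := by
    refine (isCompact_sphere (0 : ι → ℝ) 1).eventually_forall_of_forall_eventually fun v hv => ?_
    refine (hc.tendsto (x₀, v)).eventually (lt_mem_nhds ?_)
    refine (posDef_real_iff.mp h₀).2 v ?_
    rintro rfl
    simp at hv
  filter_upwards [h] with x hx
  refine posDef_real_iff.mpr ⟨hs x, fun v hv => ?_⟩
  have hv' : 0 < ‖v‖ := norm_pos_iff.mpr hv
  have h1 := hx (‖v‖⁻¹ • v) (by simp [norm_smul, hv'.ne'])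
  rw [mulVec_smul, smul_dotProduct, dotProduct_smul, smul_eq_mul, smul_eq_mul] at h1
  have hi : 0 < ‖v‖⁻¹ := inv_pos.mpr hv'
  exact (mul_pos_iff_of_pos_left hi).mp ((mul_pos_iff_of_pos_left hi).mp h1)

variable [DecidableEq ι]

theorem Matrix.PosDef.transpose_mul_mul {M S : Matrix ι ι ℝ} (hM : M.PosDef) (hS : IsUnit S) :
    (Sᵀ * M * S).PosDef := by
  rw [← conjTranspose_eq_transpose_of_trivial]
  exact hM.conjTranspose_mul_mul_same (mulVec_injective_of_isUnit hS)

theorem HasInvariantForm.conj {X S T : Matrix ι ι ℝ} (hST : S * T = 1) (h : HasInvariantForm X) :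
    HasInvariantForm (T * X * S) := by
  obtain ⟨M, hM, hX⟩ := h
  refine ⟨Sᵀ * M * S, hM.transpose_mul_mul (IsUnit.of_mul_eq_one T hST), ?_⟩
  have h1 : Sᵀ * (Xᵀ * M + M * X) * S = 0 := by rw [hX]; simp
  have h2 : Tᵀ * Sᵀ = 1 := by rw [← transpose_mul, hST, transpose_one]
  calc (T * X * S)ᵀ * (Sᵀ * M * S) + Sᵀ * M * S * (T * X * S)
      = Sᵀ * Xᵀ * (Tᵀ * Sᵀ) * M * S + Sᵀ * M * (S * T) * X * S := by
        simp only [transpose_mul]; noncomm_ring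
    _ = Sᵀ * (Xᵀ * M + M * X) * S := by rw [h2, hST]; noncomm_ring
    _ = 0 := h1

/-- A nonzero symmetric matrix commuting with a skew matrix `X` cannot be added to a multiple of
`X` without destroying skewness for every inner product. -/
theorem not_hasInvariantForm_smul_add {X B : Matrix ι ι ℝ} (hX : Xᵀ = -X) (hB : Bᵀ = B)
    (hB0 : B ≠ 0) (hXB : X * B = B * X) (a : ℝ) : ¬ HasInvariantForm (a • X + B) := by
  rintro ⟨M, hM, h⟩
  have h1 : trace (((a • X + B)ᵀ * M + M * (a • X + B)) * B) = 0 := by rw [h]; simp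
  have h2 : trace (X * M * B) = trace (M * X * B) := by
    rw [Matrix.mul_assoc, trace_mul_comm, Matrix.mul_assoc, ← hXB, Matrix.mul_assoc]
  have h3 : trace (M * B * B) = trace (B * M * B) := by
    rw [trace_mul_comm, Matrix.mul_assoc]
  have h4 : trace (B * M * B) = 0 := by
    simp only [transpose_add, transpose_smul, hX, hB, Matrix.add_mul, Matrix.mul_add, smul_mul,
      Matrix.mul_smul, Matrix.neg_mul, trace_add, trace_smul, trace_neg, h2, h3, smul_neg] at h1
    linarith
  apply hB0
  have h5 : ∀ i, 0 ≤ (B * M * B) i i ∧ ((B * M * B) i i = 0 → B.col i = 0) := by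
    intro i
    have : (B * M * B) i i = B.col i ⬝ᵥ M *ᵥ B.col i := by
      conv_lhs => rw [← hB]
      rw [hB, Matrix.mul_assoc, Matrix.mul_apply]
      simp only [dotProduct, mulVec, Matrix.mul_apply, col_apply]
      refine Finset.sum_congr rfl fun j _ => ?_
      rw [← hB, transpose_apply, hB]
    rw [this]
    have hp := (posDef_real_iff.mp hM).2 (B.col i)
    refine ⟨?_, fun h0 => ?_⟩
    · by_cases hz : B.col i = 0
      · simp [hz]
      · exact (hp hz).le
    · by_contra hz
      exact (hp hz).ne' h0
  have h6 := (Finset.sum_eq_zero_iff_of_nonneg (fun i _ => (h5 i).1)).mp h4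
  ext i j
  exact congrFun ((h5 j).2 (h6 j (Finset.mem_univ j))) i

theorem Matrix.PosDef.exists_sqrt {A : Matrix ι ι ℝ} (hA : A.PosDef) :
    ∃ R : Matrix ι ι ℝ, R.PosDef ∧ R * R = A ∧ ∀ C, C * A = A * C → C * R = R * C := by
  have hsa : IsSelfAdjoint A := hA.isHermitian
  have hc : ∀ f : ℝ → ℝ, ContinuousOn f (spectrum ℝ A) := fun f =>
    (Matrix.finite_real_spectrum (A := A)).continuousOn f
  have hpos : ∀ x ∈ spectrum ℝ A, 0 ≤ x := fun x hx => by
    rw [hA.isHermitian.spectrum_real_eq_range_eigenvalues] at hx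
    obtain ⟨i, rfl⟩ := hx
    exact (hA.eigenvalues_pos i).le
  have hR2 : cfc Real.sqrt A * cfc Real.sqrt A = A := by
    rw [← cfc_mul _ _ A (hc _) (hc _)]
    conv_rhs => rw [← cfc_id ℝ A hsa]
    exact cfc_congr fun x hx => Real.mul_self_sqrt (hpos x hx)
  have hT2 : cfc (fun x => √√x) A * cfc (fun x => √√x) A = cfc Real.sqrt A := by
    rw [← cfc_mul _ _ A (hc _) (hc _)]
    exact cfc_congr fun x hx => Real.mul_self_sqrt (Real.sqrt_nonneg x)
  have hTsa : IsSelfAdjoint (cfc (fun x => √√x) A) := cfc_predicate _ _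
  refine ⟨cfc Real.sqrt A, ?_, hR2, fun C hC => ?_⟩
  · have hRu : IsUnit (cfc Real.sqrt A) := by
      have := hA.isUnit
      rw [← hR2] at this
      exact isUnit_of_mul_isUnit_left this
    have hTu : IsUnit (cfc (fun x => √√x) A) := by
      rw [← hT2] at hRu
      exact isUnit_of_mul_isUnit_left hRu
    have := Matrix.PosDef.conjTranspose_mul_self _ (mulVec_injective_of_isUnit hTu)
    rwa [← star_eq_conjTranspose, hTsa.star_eq, hT2] at this
  · exact ((hsa.commute_cfc (show Commute A C from hC.symm) Real.sqrt).symm)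

theorem isCompact_setOf_transpose_mul_self_eq_one :
    IsCompact {U : Matrix ι ι ℝ | Uᵀ * U = 1} := by
  have hbox : IsCompact (Set.univ.pi fun _ : ι => Set.univ.pi fun _ : ι => Set.Icc (-1 : ℝ) 1) :=
    isCompact_univ_pi fun _ => isCompact_univ_pi fun _ => isCompact_Icc
  refine hbox.of_isClosed_subset ?_ fun (U : Matrix ι ι ℝ) hU i _ j _ => ?_
  · exact isClosed_eq (by fun_prop : Continuous fun U : Matrix ι ι ℝ => Uᵀ * U) continuous_const
  · have hU' : U ∈ unitaryGroup ι ℝ := by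
      rw [mem_unitaryGroup_iff', star_eq_conjTranspose, conjTranspose_eq_transpose_of_trivial]
      exact hU
    exact abs_le.mp (entry_norm_bound_of_unitary hU' i j)

theorem isCompact_setOf_transpose_mul_mul_eq {M : Matrix ι ι ℝ} (hM : M.PosDef) :
    IsCompact {S : Matrix ι ι ℝ | Sᵀ * M * S = M} := by
  obtain ⟨R, hR, hRR, -⟩ := hM.exists_sqrt
  have hd : IsUnit R.det := (isUnit_iff_isUnit_det R).mp hR.isUnit
  have hRt : Rᵀ = R := (posDef_real_iff.mp hR).1
  refine ((isCompact_setOf_transpose_mul_self_eq_one (ι := ι)).image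
    (by fun_prop : Continuous fun U : Matrix ι ι ℝ => R⁻¹ * U * R)).of_isClosed_subset
    ?_ fun S hS => ⟨R * S * R⁻¹, ?_, ?_⟩
  · exact isClosed_eq (by fun_prop : Continuous fun S : Matrix ι ι ℝ => Sᵀ * M * S)
      continuous_const
  · have hS' : Sᵀ * (R * R) * S = R * R := by rw [hRR]; exact hS
    calc (R * S * R⁻¹)ᵀ * (R * S * R⁻¹) = R⁻¹ * (Sᵀ * (R * R) * S) * R⁻¹ := by
          simp only [transpose_mul, transpose_nonsing_inv, hRt]; noncomm_ring
      _ = (R⁻¹ * R) * (R * R⁻¹) := by rw [hS']; noncomm_ring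
      _ = 1 := by rw [nonsing_inv_mul R hd, mul_nonsing_inv R hd, Matrix.one_mul]
  · calc R⁻¹ * (R * S * R⁻¹) * R = (R⁻¹ * R) * S * (R⁻¹ * R) := by noncomm_ring
      _ = S := by rw [nonsing_inv_mul R hd, Matrix.one_mul, Matrix.mul_one]

attribute [local instance] Matrix.normedAddCommGroup Matrix.normedSpace in
open Filter Topology in
/-- A matrix all of whose powers stay in a compact set of invertible matrices preserves an inner
product, obtained by averaging. -/
theorem exists_posDef_of_pow_mem_isCompact {G : Set (Matrix ι ι ℝ)} (hG : IsCompact G)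
    (hu : ∀ g ∈ G, IsUnit g) {S : Matrix ι ι ℝ} (hS : ∀ k : ℕ, S ^ k ∈ G) :
    ∃ M : Matrix ι ι ℝ, M.PosDef ∧ Sᵀ * M * S = M := by
  have hcont : Continuous fun g : Matrix ι ι ℝ => gᵀ * g := by fun_prop
  set I : Set (Matrix ι ι ℝ) := (fun g : Matrix ι ι ℝ => gᵀ * g) '' G
  have hIb : Bornology.IsBounded I := (hG.image hcont).isBounded
  obtain ⟨C, hC⟩ := hIb.exists_norm_le
  have hKc : IsCompact (closure (convexHull ℝ I)) :=
    Metric.isCompact_of_isClosed_isBounded isClosed_closure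
      (isBounded_convexHull.mpr hIb).closure
  have hKpos : ∀ M ∈ closure (convexHull ℝ I), M.PosDef := by
    intro M hM
    refine posDef_real_iff.mpr ⟨?_, fun v hv => ?_⟩
    · have hcl : IsClosed {M : Matrix ι ι ℝ | Mᵀ = M} :=
        isClosed_eq (by fun_prop) continuous_id
      have hcv : Convex ℝ {M : Matrix ι ι ℝ | Mᵀ = M} := by
        intro M hM N hN a b _ _ _
        simp only [Set.mem_ofPred_eq] at hM hN ⊢
        rw [transpose_add, transpose_smul, transpose_smul, hM, hN]
      refine closure_minimal (convexHull_min ?_ hcv) hcl hM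
      rintro _ ⟨g, -, rfl⟩
      simp
    · have hcg : Continuous fun g : Matrix ι ι ℝ => v ⬝ᵥ (gᵀ * g) *ᵥ v := by fun_prop
      obtain ⟨g₀, hg₀, hmin⟩ := hG.exists_isMinOn ⟨_, hS 0⟩ hcg.continuousOn
      have hpos : 0 < v ⬝ᵥ (g₀ᵀ * g₀) *ᵥ v := by
        have := Matrix.PosDef.one (n := ι) (R := ℝ) |>.transpose_mul_mul (hu g₀ hg₀)
        rw [Matrix.mul_one] at this
        exact (posDef_real_iff.mp this).2 v hv
      refine hpos.trans_le ?_
      have hcl : IsClosed {M : Matrix ι ι ℝ | v ⬝ᵥ (g₀ᵀ * g₀) *ᵥ v ≤ v ⬝ᵥ M *ᵥ v} :=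
        isClosed_le continuous_const (by fun_prop)
      have hcv : Convex ℝ {M : Matrix ι ι ℝ | v ⬝ᵥ (g₀ᵀ * g₀) *ᵥ v ≤ v ⬝ᵥ M *ᵥ v} := by
        refine convex_halfSpace_ge (𝕜 := ℝ) (f := fun M : Matrix ι ι ℝ => v ⬝ᵥ M *ᵥ v) ⟨?_, ?_⟩ _
        · intro M N; simp [add_mulVec]
        · intro c M; simp [smul_mulVec]
      refine closure_minimal (convexHull_min ?_ hcv) hcl hM
      rintro _ ⟨g, hg, rfl⟩
      exact hmin hg
  let A : ℕ → Matrix ι ι ℝ := fun N =>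
    ((N : ℝ) + 1)⁻¹ • ∑ k ∈ Finset.range (N + 1), (S ^ k)ᵀ * S ^ k
  have hA : ∀ N, A N ∈ closure (convexHull ℝ I) := by
    intro N
    refine subset_closure ?_
    simp only [A, Finset.smul_sum]
    refine (convex_convexHull ℝ I).sum_mem (fun _ _ => by positivity) ?_
      fun k _ => subset_convexHull ℝ I ⟨_, hS k, rfl⟩
    rw [Finset.sum_const, Finset.card_range, nsmul_eq_mul]
    push_cast
    exact mul_inv_cancel₀ (by positivity)
  have : FirstCountableTopology (Matrix ι ι ℝ) :=
    inferInstanceAs (FirstCountableTopology (ι → ι → ℝ))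
  obtain ⟨M, hM, φ, hφ, hlim⟩ := hKc.tendsto_subseq hA
  refine ⟨M, hKpos M hM, ?_⟩
  have hdiff : ∀ N, Sᵀ * A N * S - A N =
      ((N : ℝ) + 1)⁻¹ • ((S ^ (N + 1))ᵀ * S ^ (N + 1) - (S ^ 0)ᵀ * S ^ 0) := by
    intro N
    rw [← Finset.sum_range_sub (fun k => (S ^ k)ᵀ * S ^ k), Finset.sum_sub_distrib, smul_sub]
    simp only [A]
    rw [Matrix.mul_smul, smul_mul, Finset.mul_sum, Finset.sum_mul]
    congr 2
    refine Finset.sum_congr rfl fun k _ => ?_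
    rw [pow_succ, transpose_mul]
    noncomm_ring
  have hzero : Tendsto (fun N => Sᵀ * A N * S - A N) atTop (𝓝 0) := by
    refine squeeze_zero_norm (a := fun N : ℕ => ((N : ℝ) + 1)⁻¹ * (C + C)) (fun N => ?_) ?_
    · rw [hdiff, norm_smul, Real.norm_of_nonneg (by positivity)]
      gcongr
      exact (norm_sub_le _ _).trans (add_le_add (hC _ ⟨_, hS _, rfl⟩) (hC _ ⟨_, hS 0, rfl⟩))
    · have := (tendsto_one_div_add_atTop_nhds_zero_nat (𝕜 := ℝ)).mul_const (C + C)
      simpa [one_div] using this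
  have hlim2 : Tendsto (fun k => Sᵀ * A (φ k) * S - A (φ k)) atTop (𝓝 (Sᵀ * M * S - M)) :=
    ((by fun_prop : Continuous fun M : Matrix ι ι ℝ => Sᵀ * M * S - M).tendsto M).comp hlim
  exact sub_eq_zero.mp (tendsto_nhds_unique hlim2 (hzero.comp hφ.tendsto_atTop))

end InvariantForm

section Symplectic

open Polynomial

theorem aeval_intertwine {ι : Type*} [Fintype ι] [DecidableEq ι] {A B T : Matrix ι ι ℝ}
    (h : T * A = B * T) (q : ℝ[X]) : T * aeval A q = aeval B q * T := by
  induction q using Polynomial.induction_on' with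
  | add p q hp hq => rw [map_add, map_add, Matrix.mul_add, Matrix.add_mul, hp, hq]
  | monomial k a =>
    rw [aeval_monomial, aeval_monomial, ← Algebra.smul_def, ← Algebra.smul_def, Matrix.mul_smul,
      smul_mul, (show SemiconjBy T A B from h).pow_right k]

theorem transpose_aeval {ι : Type*} [Fintype ι] [DecidableEq ι] (A : Matrix ι ι ℝ) (q : ℝ[X]) :
    (aeval A q)ᵀ = aeval Aᵀ q := by
  induction q using Polynomial.induction_on' with
  | add p q hp hq => rw [map_add, map_add, transpose_add, hp, hq]
  | monomial k a =>
    rw [aeval_monomial, aeval_monomial, ← Algebra.smul_def, ← Algebra.smul_def, transpose_smul,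
      transpose_pow]

variable {n : ℕ}

theorem Omega_transpose : (Omega n)ᵀ = -Omega n := by
  simp [Omega, fromBlocks_transpose, fromBlocks_neg]

theorem Omega_mul_Omega : Omega n * Omega n = -1 := by
  rw [Omega, fromBlocks_multiply, ← fromBlocks_one, fromBlocks_neg]
  simp

theorem Omega_mul_Omega_mul (A : Matrix (Fin n ⊕ Fin n) (Fin n ⊕ Fin n) ℝ) :
    Omega n * (Omega n * A) = -A := by
  rw [← Matrix.mul_assoc, Omega_mul_Omega, Matrix.neg_mul, Matrix.one_mul]

theorem isUnit_Omega : IsUnit (Omega n) :=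
  IsUnit.of_mul_eq_one (-Omega n) (by rw [Matrix.mul_neg, Omega_mul_Omega, neg_neg])

section

variable {S X : Matrix (Fin n ⊕ Fin n) (Fin n ⊕ Fin n) ℝ}

theorem mem_sp_iff : X ∈ sp n ↔ Xᵀ * Omega n = -(Omega n * X) :=
  add_eq_zero_iff_eq_neg

theorem isUnit_of_mem_Sp (hS : S ∈ Sp n) : IsUnit S := by
  refine IsUnit.of_mul_eq_one_right (-(Omega n * Sᵀ * Omega n)) ?_
  have hS' : Sᵀ * Omega n * S = Omega n := hS
  rw [Matrix.neg_mul, Matrix.mul_assoc, Matrix.mul_assoc, ← Matrix.mul_assoc Sᵀ, hS',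
    Omega_mul_Omega, neg_neg]

theorem inv_mul_of_mem_Sp (hS : S ∈ Sp n) : S⁻¹ * S = 1 :=
  nonsing_inv_mul S ((isUnit_iff_isUnit_det S).mp (isUnit_of_mem_Sp hS))

theorem mul_inv_of_mem_Sp (hS : S ∈ Sp n) : S * S⁻¹ = 1 :=
  mul_nonsing_inv S ((isUnit_iff_isUnit_det S).mp (isUnit_of_mem_Sp hS))

theorem transpose_mul_Omega_of_mem_Sp (hS : S ∈ Sp n) : Sᵀ * Omega n = Omega n * S⁻¹ := by
  have hS' : Sᵀ * Omega n * S = Omega n := hS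
  conv_rhs => rw [← hS', Matrix.mul_assoc, mul_inv_of_mem_Sp hS, Matrix.mul_one]

theorem inv_mem_Sp (hS : S ∈ Sp n) : S⁻¹ ∈ Sp n := by
  have hS' : Sᵀ * Omega n * S = Omega n := hS
  have h : S⁻¹ᵀ * Sᵀ = 1 := by rw [← transpose_mul, mul_inv_of_mem_Sp hS, transpose_one]
  change S⁻¹ᵀ * Omega n * S⁻¹ = Omega n
  calc S⁻¹ᵀ * Omega n * S⁻¹ = (S⁻¹ᵀ * Sᵀ) * Omega n * (S * S⁻¹) := by
        conv_lhs => rw [← hS']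
        noncomm_ring
    _ = Omega n := by rw [h, mul_inv_of_mem_Sp hS, Matrix.one_mul, Matrix.mul_one]

theorem conj_mem_sp (hS : S ∈ Sp n) (hX : X ∈ sp n) : S⁻¹ * X * S ∈ sp n := by
  have h1 := transpose_mul_Omega_of_mem_Sp hS
  have h2 := transpose_mul_Omega_of_mem_Sp (inv_mem_Sp hS)
  rw [nonsing_inv_nonsing_inv S ((isUnit_iff_isUnit_det S).mp (isUnit_of_mem_Sp hS))] at h2
  rw [mem_sp_iff] at hX ⊢
  calc (S⁻¹ * X * S)ᵀ * Omega n = Sᵀ * (Xᵀ * (S⁻¹ᵀ * Omega n)) := by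
        simp only [transpose_mul, Matrix.mul_assoc]
    _ = Sᵀ * (Xᵀ * Omega n) * S := by rw [h2]; noncomm_ring
    _ = -(Sᵀ * Omega n * X * S) := by rw [hX]; noncomm_ring
    _ = -(Omega n * (S⁻¹ * X * S)) := by rw [h1]; noncomm_ring

theorem pow_mem_Sp (hS : S ∈ Sp n) (k : ℕ) : S ^ k ∈ Sp n := by
  induction k with
  | zero => simp [Sp]
  | succ k ih =>
    have hS' : Sᵀ * Omega n * S = Omega n := hS
    have ih' : (S ^ k)ᵀ * Omega n * S ^ k = Omega n := ih
    change (S ^ (k + 1))ᵀ * Omega n * S ^ (k + 1) = Omega n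
    calc (S ^ (k + 1))ᵀ * Omega n * S ^ (k + 1) = Sᵀ * ((S ^ k)ᵀ * Omega n * S ^ k) * S := by
          rw [pow_succ, transpose_mul]; noncomm_ring
      _ = Omega n := by rw [ih', hS']

end

theorem transpose_eq_neg_of_mem_sp_of_commute_Omega
    {Y : Matrix (Fin n ⊕ Fin n) (Fin n ⊕ Fin n) ℝ} (hY : Y ∈ sp n)
    (h : Y * Omega n = Omega n * Y) : Yᵀ = -Y := by
  rw [mem_sp_iff, ← h, ← Matrix.neg_mul] at hY
  exact isUnit_Omega.mul_left_injective hY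

/-- The positive definite square root of a positive definite symplectic matrix is symplectic. -/
theorem Matrix.PosDef.exists_sqrt_mem_Sp {N : Matrix (Fin n ⊕ Fin n) (Fin n ⊕ Fin n) ℝ}
    (hN : N.PosDef) (hNΩ : N * Omega n * N = Omega n) :
    ∃ T : Matrix (Fin n ⊕ Fin n) (Fin n ⊕ Fin n) ℝ,
      T.PosDef ∧ T * T = N ∧ T * Omega n * T = Omega n := by
  obtain ⟨T, hT, hTT, hTc⟩ := hN.exists_sqrt
  refine ⟨T, hT, hTT, ?_⟩
  set W := (Omega n)ᵀ * T * Omega n with hW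
  have hWpos : W.PosDef := hT.transpose_mul_mul isUnit_Omega
  have hWWN : W * W * N = 1 := by
    calc W * W * N = -(Omega n * T * (-(Omega n * Omega n)) * T * Omega n * N) := by
          rw [hW, Omega_transpose]; noncomm_ring
      _ = -(Omega n * (T * T) * Omega n * N) := by rw [Omega_mul_Omega]; noncomm_ring
      _ = -(Omega n * (N * Omega n * N)) := by rw [hTT]; noncomm_ring
      _ = 1 := by rw [hNΩ, Omega_mul_Omega, neg_neg]
  have hNWW : N * (W * W) = 1 := mul_eq_one_comm.mp hWWN
  have hWN : W * N = N * W := by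
    calc W * N = N * (W * W) * (W * N) := by rw [hNWW, Matrix.one_mul]
      _ = N * W * (W * W * N) := by noncomm_ring
      _ = N * W := by rw [hWWN, Matrix.mul_one]
  have hWT : W * T = T * W := hTc W hWN
  obtain ⟨V, hV, hVV, hVc⟩ := hWpos.exists_sqrt
  have hTV : T * V = V * T := hVc T hWT.symm
  have hpos : (W * T).PosDef := by
    have h := hT.transpose_mul_mul hV.isUnit
    rwa [(posDef_real_iff.mp hV).1, Matrix.mul_assoc, hTV, ← Matrix.mul_assoc, hVV] at h
  have hprod : (W * T + 1) * (W * T - 1) = 0 := by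
    have : W * T * (W * T) = 1 := by
      calc W * T * (W * T) = W * (T * W) * T := by noncomm_ring
        _ = W * W * (T * T) := by rw [← hWT]; noncomm_ring
        _ = 1 := by rw [hTT, hWWN]
    calc (W * T + 1) * (W * T - 1) = W * T * (W * T) - 1 := by noncomm_ring
      _ = 0 := by rw [this, sub_self]
  have hone : W * T = 1 := by
    have hu : IsUnit (W * T + 1) := (hpos.add PosDef.one).isUnit
    exact sub_eq_zero.mp ((hu.mul_right_eq_zero).mp hprod)
  calc T * Omega n * T = -(Omega n * (Omega n * (T * Omega n * T))) := by
        rw [Omega_mul_Omega_mul, neg_neg]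
    _ = Omega n * (W * T) := by rw [hW, Omega_transpose]; noncomm_ring
    _ = Omega n := by rw [hone, Matrix.mul_one]

theorem transpose_conj_eq_neg {ι : Type*} [Fintype ι] [DecidableEq ι] {X R M : Matrix ι ι ℝ}
    (hR : R.PosDef) (hRM : R * R = M) (h : Xᵀ * M + M * X = 0) :
    (R * X * R⁻¹)ᵀ = -(R * X * R⁻¹) := by
  have hd : IsUnit R.det := (isUnit_iff_isUnit_det R).mp hR.isUnit
  have hRt : Rᵀ = R := (posDef_real_iff.mp hR).1
  rw [← add_eq_zero_iff_eq_neg]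
  calc (R * X * R⁻¹)ᵀ + R * X * R⁻¹
      = R⁻¹ * Xᵀ * R * (R * R⁻¹) + (R⁻¹ * R) * R * X * R⁻¹ := by
        rw [nonsing_inv_mul R hd, mul_nonsing_inv R hd]
        simp only [transpose_mul, transpose_nonsing_inv, hRt, Matrix.one_mul, Matrix.mul_one,
          Matrix.mul_assoc]
    _ = R⁻¹ * (Xᵀ * (R * R) + (R * R) * X) * R⁻¹ := by noncomm_ring
    _ = 0 := by rw [hRM, h]; simp

set_option maxHeartbeats 1000000 in
/-- A Hamiltonian matrix preserving an inner product preserves one compatible with the symplectic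
form. -/
theorem exists_posDef_compatible {X : Matrix (Fin n ⊕ Fin n) (Fin n ⊕ Fin n) ℝ} (hX : X ∈ sp n)
    (h : HasInvariantForm X) :
    ∃ N : Matrix (Fin n ⊕ Fin n) (Fin n ⊕ Fin n) ℝ,
      N.PosDef ∧ N * Omega n * N = Omega n ∧ Xᵀ * N + N * X = 0 := by
  obtain ⟨M, hM, hXM⟩ := h
  obtain ⟨R, hR, hRR, -⟩ := hM.exists_sqrt
  have hd : IsUnit R.det := (isUnit_iff_isUnit_det R).mp hR.isUnit
  have hRt : Rᵀ = R := (posDef_real_iff.mp hR).1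
  have hr1 := nonsing_inv_mul R hd
  have hr2 := mul_nonsing_inv R hd
  have hskew := transpose_conj_eq_neg hR hRR hXM
  set Y := R * X * R⁻¹ with hY
  have hYt : Yᵀ = R⁻¹ * Xᵀ * R := by
    simp only [hY, transpose_mul, transpose_nonsing_inv, hRt, Matrix.mul_assoc]
  set K := R⁻¹ * Omega n * R⁻¹ with hK
  have hKt : Kᵀ = -K := by
    simp only [hK, transpose_mul, transpose_nonsing_inv, hRt, Omega_transpose]
    noncomm_ring
  have hKu : IsUnit K := by
    have hRi : IsUnit R⁻¹ := hR.inv.isUnit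
    exact (hRi.mul isUnit_Omega).mul hRi
  have hKK : (Kᵀ * K).PosDef := by
    have := (PosDef.one (n := Fin n ⊕ Fin n) (R := ℝ)).transpose_mul_mul hKu
    rwa [Matrix.mul_one] at this
  obtain ⟨P, hP, hPP, hPc⟩ := hKK.exists_sqrt
  have hKP : K * P = P * K := hPc K (by rw [hKt]; noncomm_ring)
  have hYK : Y * K = K * Y := by
    have h0 : Xᵀ * Omega n + Omega n * X = 0 := hX
    have h1 : R⁻¹ * (Xᵀ * Omega n + Omega n * X) * R⁻¹ = 0 := by rw [h0]; simp
    have h2 : Yᵀ * K + K * Y = R⁻¹ * (Xᵀ * Omega n + Omega n * X) * R⁻¹ := by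
      calc Yᵀ * K + K * Y = R⁻¹ * Xᵀ * (R * R⁻¹) * Omega n * R⁻¹
            + R⁻¹ * Omega n * (R⁻¹ * R) * X * R⁻¹ := by
            rw [hYt, hY, hK]; noncomm_ring
        _ = _ := by rw [hr1, hr2]; noncomm_ring
    rw [h1, hskew, Matrix.neg_mul] at h2
    exact (neg_add_eq_zero.mp h2)
  have hYP : Y * P = P * Y := by
    refine hPc Y ?_
    rw [hKt]
    calc Y * (-K * K) = -(Y * K * K) := by noncomm_ring
      _ = -(K * Y * K) := by rw [hYK]
      _ = -(K * (Y * K)) := by rw [Matrix.mul_assoc]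
      _ = -K * K * Y := by rw [hYK]; noncomm_ring
  refine ⟨R * P * R, ?_, ?_, ?_⟩
  · have := hP.transpose_mul_mul hR.isUnit
    rwa [hRt] at this
  · set L := R * Omega n * R with hL
    have hLK : L * K = -1 := by
      calc L * K = R * Omega n * (R * R⁻¹) * Omega n * R⁻¹ := by rw [hL, hK]; noncomm_ring
        _ = R * (Omega n * Omega n) * R⁻¹ := by rw [hr2]; noncomm_ring
        _ = -(R * R⁻¹) := by rw [Omega_mul_Omega]; noncomm_ring
        _ = -1 := by rw [hr2]
    have hKL : K * L = -1 := by
      have : -L * K = 1 := by rw [Matrix.neg_mul, hLK, neg_neg]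
      have := mul_eq_one_comm.mp this
      rw [Matrix.mul_neg] at this
      rw [← this, neg_neg]
    have hPL : P * L = L * P := by
      calc P * L = -(L * K) * (P * L) := by rw [hLK]; noncomm_ring
        _ = -(L * (K * P) * L) := by noncomm_ring
        _ = -(L * P * (K * L)) := by rw [hKP]; noncomm_ring
        _ = L * P := by rw [hKL]; noncomm_ring
    calc R * P * R * Omega n * (R * P * R) = R * (P * L) * P * R := by rw [hL]; noncomm_ring
      _ = R * L * (P * P) * R := by rw [hPL]; noncomm_ring
      _ = -(R * (L * K) * K * R) := by rw [hPP, hKt]; noncomm_ring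
      _ = (R * R⁻¹) * Omega n * (R⁻¹ * R) := by rw [hLK, hK]; noncomm_ring
      _ = Omega n := by rw [hr1, hr2, Matrix.one_mul, Matrix.mul_one]
  · calc Xᵀ * (R * P * R) + R * P * R * X
        = (R * R⁻¹) * Xᵀ * R * P * R + R * P * R * X * (R⁻¹ * R) := by
          rw [hr1, hr2]; noncomm_ring
      _ = R * (Yᵀ * P + P * Y) * R := by rw [hYt, hY]; noncomm_ring
      _ = 0 := by rw [hskew, Matrix.neg_mul, hYP]; simp

/-- A Hamiltonian matrix preserving an inner product is stable. -/
theorem stable_of_hasInvariantForm {X : Matrix (Fin n ⊕ Fin n) (Fin n ⊕ Fin n) ℝ} (hX : X ∈ sp n)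
    (h : HasInvariantForm X) :
    ∃ S ∈ Sp n, (S⁻¹ * X * S) * Omega n = Omega n * (S⁻¹ * X * S) := by
  obtain ⟨N, hN, hNΩ, hXN⟩ := exists_posDef_compatible hX h
  obtain ⟨T, hT, hTT, hTΩ⟩ := hN.exists_sqrt_mem_Sp hNΩ
  have hd : IsUnit T.det := (isUnit_iff_isUnit_det T).mp hT.isUnit
  have hTSp : T ∈ Sp n := by
    change Tᵀ * Omega n * T = Omega n
    rw [(posDef_real_iff.mp hT).1, hTΩ]
  have hskew := transpose_conj_eq_neg hT hTT hXN
  refine ⟨T⁻¹, inv_mem_Sp hTSp, ?_⟩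
  have hsp := conj_mem_sp (inv_mem_Sp hTSp) hX
  rw [mem_sp_iff] at hsp
  rw [nonsing_inv_nonsing_inv T hd] at hsp ⊢
  rw [hskew, Matrix.neg_mul] at hsp
  exact neg_injective hsp

theorem hasInvariantForm_of_stable {X : Matrix (Fin n ⊕ Fin n) (Fin n ⊕ Fin n) ℝ} (hX : X ∈ sp n)
    (h : ∃ S ∈ Sp n, (S⁻¹ * X * S) * Omega n = Omega n * (S⁻¹ * X * S)) :
    HasInvariantForm X := by
  obtain ⟨S, hS, hSX⟩ := h
  have hskew := transpose_eq_neg_of_mem_sp_of_commute_Omega (conj_mem_sp hS hX) hSX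
  have h1 : HasInvariantForm (S⁻¹ * X * S) :=
    ⟨1, PosDef.one, by rw [hskew, Matrix.mul_one, Matrix.one_mul, neg_add_cancel]⟩
  have h2 := h1.conj (inv_mul_of_mem_Sp hS)
  rwa [show S * (S⁻¹ * X * S) * S⁻¹ = (S * S⁻¹) * X * (S * S⁻¹) by noncomm_ring,
    mul_inv_of_mem_Sp hS, Matrix.one_mul, Matrix.mul_one] at h2

/-- If the symplectic centralizer of `X` is compact, every Hamiltonian matrix commuting with `X`
preserves an inner product: the Cayley transform of a small multiple of it lies in the
centralizer. -/
theorem hasInvariantForm_of_isCompact_centralizer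
    {X B : Matrix (Fin n ⊕ Fin n) (Fin n ⊕ Fin n) ℝ} (hB : B ∈ sp n) (hXB : X * B = B * X)
    (hG : IsCompact {S ∈ Sp n | S * X = X * S}) : HasInvariantForm B := by
  obtain ⟨s, hs, hs0⟩ : ∃ s : ℝ, IsUnit (1 - s • B) ∧ s ≠ 0 := by
    have hc : Continuous fun s : ℝ => (1 - s • B).det := by fun_prop
    have h1 : ∀ᶠ s in nhds (0 : ℝ), (1 - s • B).det ≠ 0 :=
      hc.continuousAt.eventually_ne (by simp)
    obtain ⟨s, hs, hs0⟩ :=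
      ((h1.filter_mono nhdsWithin_le_nhds).and (self_mem_nhdsWithin (s := {(0 : ℝ)}ᶜ))).exists
    exact ⟨s, (isUnit_iff_isUnit_det _).mpr hs.isUnit, hs0⟩
  set E := 1 - s • B with hE
  set F := 1 + s • B with hF
  have hd : IsUnit E.det := (isUnit_iff_isUnit_det E).mp hs
  have hB' := mem_sp_iff.mp hB
  have hFΩ : Fᵀ * Omega n = Omega n * E := by
    rw [hF, hE, transpose_add, transpose_one, transpose_smul, Matrix.add_mul, smul_mul, hB',
      Matrix.mul_sub, Matrix.mul_smul, Matrix.one_mul, Matrix.mul_one, smul_neg, sub_eq_add_neg]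
  have hEΩ : Eᵀ * Omega n = Omega n * F := by
    rw [hF, hE, transpose_sub, transpose_one, transpose_smul, Matrix.sub_mul, smul_mul, hB',
      Matrix.mul_add, Matrix.mul_smul, Matrix.one_mul, Matrix.mul_one, smul_neg, sub_neg_eq_add]
  have hEF : E * F = F * E := by
    rw [hE, hF]
    simp only [Matrix.add_mul, Matrix.mul_add, Matrix.sub_mul, Matrix.mul_sub, Matrix.one_mul,
      Matrix.mul_one]
    abel
  have hXE : X * E = E * X := by
    rw [hE, Matrix.mul_sub, Matrix.sub_mul, Matrix.mul_smul, smul_mul, hXB, Matrix.mul_one,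
      Matrix.one_mul]
  have hXF : X * F = F * X := by
    rw [hF, Matrix.mul_add, Matrix.add_mul, Matrix.mul_smul, smul_mul, hXB, Matrix.mul_one,
      Matrix.one_mul]
  have he1 := nonsing_inv_mul E hd
  have he2 := mul_nonsing_inv E hd
  have het : E⁻¹ᵀ * Eᵀ = 1 := by rw [← transpose_mul, he2, transpose_one]
  have hXEi : X * E⁻¹ = E⁻¹ * X := by
    calc X * E⁻¹ = E⁻¹ * (E * X) * E⁻¹ := by
          rw [← Matrix.mul_assoc E⁻¹, he1, Matrix.one_mul]
      _ = E⁻¹ * X * (E * E⁻¹) := by rw [← hXE]; noncomm_ring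
      _ = E⁻¹ * X := by rw [he2, Matrix.mul_one]
  have hS : F * E⁻¹ ∈ Sp n := by
    change (F * E⁻¹)ᵀ * Omega n * (F * E⁻¹) = Omega n
    calc (F * E⁻¹)ᵀ * Omega n * (F * E⁻¹) = E⁻¹ᵀ * (Fᵀ * Omega n) * F * E⁻¹ := by
          rw [transpose_mul]; noncomm_ring
      _ = E⁻¹ᵀ * Omega n * (E * F) * E⁻¹ := by rw [hFΩ]; noncomm_ring
      _ = E⁻¹ᵀ * (Omega n * F) * (E * E⁻¹) := by rw [hEF]; noncomm_ring
      _ = (E⁻¹ᵀ * Eᵀ) * Omega n := by rw [← hEΩ, he2]; noncomm_ring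
      _ = Omega n := by rw [het, Matrix.one_mul]
  have hSX : Commute (F * E⁻¹) X := by
    change F * E⁻¹ * X = X * (F * E⁻¹)
    rw [Matrix.mul_assoc, ← hXEi, ← Matrix.mul_assoc, ← hXF, Matrix.mul_assoc]
  obtain ⟨M, hM, hSM⟩ := exists_posDef_of_pow_mem_isCompact hG
    (fun g hg => isUnit_of_mem_Sp hg.1) (fun k => ⟨pow_mem_Sp hS k, hSX.pow_left k⟩)
  refine ⟨M, hM, ?_⟩
  have h1 : Fᵀ * M * F = Eᵀ * M * E := by
    have : Eᵀ * E⁻¹ᵀ = 1 := by rw [← transpose_mul, he1, transpose_one]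
    calc Fᵀ * M * F = (Eᵀ * E⁻¹ᵀ) * Fᵀ * M * F * (E⁻¹ * E) := by
          rw [this, he1, Matrix.one_mul, Matrix.mul_one]
      _ = Eᵀ * ((F * E⁻¹)ᵀ * M * (F * E⁻¹)) * E := by rw [transpose_mul]; noncomm_ring
      _ = Eᵀ * M * E := by rw [hSM]
  have h2 : Fᵀ * M * F - Eᵀ * M * E = (2 * s) • (Bᵀ * M + M * B) := by
    rw [hE, hF]
    simp only [transpose_add, transpose_sub, transpose_one, transpose_smul, Matrix.add_mul,
      Matrix.mul_add, Matrix.sub_mul, Matrix.mul_sub, smul_mul, Matrix.mul_smul, Matrix.one_mul,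
      Matrix.mul_one]
    module
  rw [h1, sub_self] at h2
  exact (smul_eq_zero.mp h2.symm).resolve_left (by simpa using hs0)

theorem exists_eval_eq_inv (s : Finset ℝ) (hs : ∀ x ∈ s, ∀ y ∈ s, x + y ≠ 0) :
    ∃ q : ℝ[X], ∀ x ∈ s, x * q.eval (-(x * x)) = 1 := by
  classical
  have hinj : Set.InjOn (fun x : ℝ => -(x * x)) (s : Set ℝ) := by
    intro x hx y hy hxy
    have h : (x - y) * (x + y) = 0 := by
      have : x * x = y * y := neg_injective hxy
      linear_combination this
    exact sub_eq_zero.mp ((mul_eq_zero.mp h).resolve_right (hs x hx y hy))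
  refine ⟨Lagrange.interpolate s (fun x : ℝ => -(x * x)) fun x => x⁻¹, fun x hx => ?_⟩
  rw [Lagrange.eval_interpolate_at_node (fun x : ℝ => x⁻¹) hinj hx]
  refine mul_inv_cancel₀ fun h0 => hs x hx x hx ?_
  rw [h0, add_zero]

theorem exists_aeval_eq_one_of_spectrum {ι : Type*} [Fintype ι] [DecidableEq ι]
    {H : Matrix ι ι ℝ} (hH : H.IsHermitian)
    (hs : ∀ i j, hH.eigenvalues i + hH.eigenvalues j ≠ 0) :
    ∃ q : ℝ[X], H * aeval (-(H * H)) q = 1 := by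
  obtain ⟨q, hq⟩ := exists_eval_eq_inv (Finset.univ.image hH.eigenvalues) (by
    simpa using fun i j => hs i j)
  refine ⟨q, ?_⟩
  have hsa : IsSelfAdjoint H := hH
  have h1 : aeval H (X * q.comp (-(X * X))) = H * aeval (-(H * H)) q := by
    rw [map_mul, aeval_X, aeval_comp, map_neg, map_mul, aeval_X]
  rw [← h1, ← cfc_polynomial _ H hsa, ← cfc_one ℝ H hsa]
  refine cfc_congr fun x hx => ?_
  rw [hH.spectrum_real_eq_range_eigenvalues] at hx
  obtain ⟨i, rfl⟩ := hx
  simpa using hq _ (Finset.mem_image_of_mem _ (Finset.mem_univ i))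

/-- Eigenvectors with opposite eigenvalues of a symmetric matrix commuting with `Omega` produce a
symmetric matrix anticommuting with both. -/
theorem exists_symmetric_anticommute {H : Matrix (Fin n ⊕ Fin n) (Fin n ⊕ Fin n) ℝ}
    (hH : Hᵀ = H) (hHΩ : H * Omega n = Omega n * H) {u w : Fin n ⊕ Fin n → ℝ} (hu : u ≠ 0)
    (hw : w ≠ 0) {c : ℝ} (hHu : H *ᵥ u = c • u) (hHw : H *ᵥ w = -c • w) :
    ∃ B : Matrix (Fin n ⊕ Fin n) (Fin n ⊕ Fin n) ℝ, Bᵀ = B ∧ B ≠ 0 ∧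
      B * Omega n = -(Omega n * B) ∧ H * B = -(B * H) := by
  set C := vecMulVec u w + vecMulVec w u with hC
  have hCt : Cᵀ = C := by
    rw [hC, transpose_add, transpose_vecMulVec, transpose_vecMulVec, add_comm]
  have hHC : H * C = c • (vecMulVec u w - vecMulVec w u) := by
    rw [hC, Matrix.mul_add, mul_vecMulVec, mul_vecMulVec, hHu, hHw, smul_vecMulVec,
      smul_vecMulVec]
    module
  have hCH : C * H = -(H * C) := by
    have : (H * C)ᵀ = C * H := by rw [transpose_mul, hH, hCt]
    rw [← this, hHC, transpose_smul, transpose_sub, transpose_vecMulVec, transpose_vecMulVec]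
    module
  refine ⟨C + Omega n * C * Omega n, ?_, ?_, ?_, ?_⟩
  · rw [transpose_add, transpose_mul, transpose_mul, hCt, Omega_transpose]
    noncomm_ring
  · intro h0
    have hval : w ⬝ᵥ (C + Omega n * C * Omega n) *ᵥ u =
        (w ⬝ᵥ w) * (u ⬝ᵥ u) + (w ⬝ᵥ u) ^ 2 + (w ⬝ᵥ Omega n *ᵥ u) ^ 2 := by
      have hskew : ∀ x y : Fin n ⊕ Fin n → ℝ, x ⬝ᵥ Omega n *ᵥ y = -(y ⬝ᵥ Omega n *ᵥ x) := by
        intro x y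
        rw [dotProduct_mulVec, ← mulVec_transpose, Omega_transpose, neg_mulVec, neg_dotProduct,
          dotProduct_comm]
      have huu : u ⬝ᵥ Omega n *ᵥ u = 0 := by linarith [hskew u u]
      have huw := hskew u w
      rw [add_mulVec, dotProduct_add, ← mulVec_mulVec, ← mulVec_mulVec, hskew w, hC]
      simp only [add_mulVec, vecMulVec_mulVec, dotProduct_add, dotProduct_smul, add_dotProduct,
        smul_dotProduct, huu, huw, op_smul_eq_smul, smul_eq_mul]
      ring
    rw [h0, zero_mulVec, dotProduct_zero] at hval
    have h1 : 0 < w ⬝ᵥ w := by simpa using dotProduct_star_self_pos_iff.mpr hw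
    have h2 : 0 < u ⬝ᵥ u := by simpa using dotProduct_star_self_pos_iff.mpr hu
    nlinarith [mul_pos h1 h2, sq_nonneg (w ⬝ᵥ u), sq_nonneg (w ⬝ᵥ Omega n *ᵥ u)]
  · calc (C + Omega n * C * Omega n) * Omega n
        = C * Omega n + Omega n * C * (Omega n * Omega n) := by
          noncomm_ring
      _ = -((Omega n * Omega n) * C * Omega n + Omega n * C) := by
        rw [Omega_mul_Omega]; noncomm_ring
      _ = -(Omega n * (C + Omega n * C * Omega n)) := by noncomm_ring
  · calc H * (C + Omega n * C * Omega n) = H * C + (H * Omega n) * C * Omega n := by noncomm_ring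
      _ = H * C + Omega n * (H * C) * Omega n := by rw [hHΩ]; noncomm_ring
      _ = -(C * H) - Omega n * C * (H * Omega n) := by
        rw [← neg_eq_iff_eq_neg.mpr hCH]; noncomm_ring
      _ = -((C + Omega n * C * Omega n) * H) := by rw [hHΩ]; noncomm_ring

theorem exists_aeval_or_exists_commuting_of_commute_Omega
    {Y : Matrix (Fin n ⊕ Fin n) (Fin n ⊕ Fin n) ℝ} (hY : Yᵀ = -Y)
    (hYΩ : Y * Omega n = Omega n * Y) :
    (∃ q : ℝ[X], Omega n * (Y * aeval (Y * Y) q) = 1) ∨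
      ∃ B : Matrix (Fin n ⊕ Fin n) (Fin n ⊕ Fin n) ℝ, Bᵀ = B ∧ B ≠ 0 ∧ B ∈ sp n ∧
        Y * B = B * Y := by
  obtain ⟨H, hH⟩ : ∃ H, H = Omega n * Y := ⟨_, rfl⟩
  have hYH : Y = -(Omega n * H) := by rw [hH, Omega_mul_Omega_mul, neg_neg]
  have hHt : Hᵀ = H := by
    rw [hH, transpose_mul, hY, Omega_transpose, neg_mul_neg, hYΩ]
  have hHh : H.IsHermitian := by
    rwa [IsHermitian, conjTranspose_eq_transpose_of_trivial]
  have hHH : -(H * H) = Y * Y := by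
    calc -(H * H) = -(Omega n * (Y * Omega n) * Y) := by rw [hH]; noncomm_ring
      _ = -((Omega n * Omega n) * Y * Y) := by rw [hYΩ]; noncomm_ring
      _ = Y * Y := by rw [Omega_mul_Omega]; noncomm_ring
  by_cases hs : ∀ i j, hHh.eigenvalues i + hHh.eigenvalues j ≠ 0
  · obtain ⟨q, hq⟩ := exists_aeval_eq_one_of_spectrum hHh hs
    exact Or.inl ⟨q, by rw [← Matrix.mul_assoc, ← hH, ← hHH, hq]⟩
  · push Not at hs
    obtain ⟨i, j, hij⟩ := hs
    have hne : ∀ k, (hHh.eigenvectorBasis k : Fin n ⊕ Fin n → ℝ) ≠ 0 := by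
      intro k h
      apply hHh.eigenvectorBasis.orthonormal.ne_zero k
      ext l
      exact congrFun h l
    have hHΩ : H * Omega n = Omega n * H := by rw [hH, Matrix.mul_assoc, hYΩ]
    obtain ⟨B, hBt, hB0, hBΩ, hHB⟩ := exists_symmetric_anticommute hHt hHΩ (hne i) (hne j)
      (hHh.mulVec_eigenvectorBasis i)
      (by rw [hHh.mulVec_eigenvectorBasis j, eq_neg_of_add_eq_zero_right hij])
    refine Or.inr ⟨B, hBt, hB0, ?_, ?_⟩
    · rw [mem_sp_iff, hBt, hBΩ]
    · calc Y * B = -(Omega n * (H * B)) := by rw [hYH]; noncomm_ring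
        _ = (Omega n * B) * H := by rw [hHB]; noncomm_ring
        _ = -(B * Omega n) * H := by rw [hBΩ, neg_neg]
        _ = B * Y := by rw [hYH]; noncomm_ring

section

variable {X : Matrix (Fin n ⊕ Fin n) (Fin n ⊕ Fin n) ℝ}

/-- For a stable `X`, either an odd polynomial in `X` is a compatible complex structure, or `X`
commutes with a Hamiltonian matrix that destroys stability. -/
theorem exists_aeval_posDef_or_exists_commuting (hX : X ∈ sp n)
    (h : ∃ S ∈ Sp n, (S⁻¹ * X * S) * Omega n = Omega n * (S⁻¹ * X * S)) :
    (∃ q : ℝ[X], (Omega n * (X * aeval (X * X) q)).PosDef) ∨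
      ∃ B ∈ sp n, X * B = B * X ∧ ∀ a : ℝ, ¬ HasInvariantForm (a • X + B) := by
  obtain ⟨S, hS, hSX⟩ := h
  have hSi := inv_mem_Sp hS
  have h1 := inv_mul_of_mem_Sp hS
  have h2 := mul_inv_of_mem_Sp hS
  have hskew := transpose_eq_neg_of_mem_sp_of_commute_Omega (conj_mem_sp hS hX) hSX
  set Y := S⁻¹ * X * S with hY
  have hXS : X * S = S * Y := by
    rw [hY, ← Matrix.mul_assoc, ← Matrix.mul_assoc, h2, Matrix.one_mul]
  have hXY : X = S * Y * S⁻¹ := by rw [← hXS, Matrix.mul_assoc, h2, Matrix.mul_one]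
  obtain ⟨q, hq⟩ | ⟨B, hBt, hB0, hB, hYB⟩ :=
    exists_aeval_or_exists_commuting_of_commute_Omega hskew hSX
  · refine Or.inl ⟨q, ?_⟩
    have hint : S * aeval (Y * Y) q = aeval (X * X) q * S := by
      refine aeval_intertwine ?_ q
      rw [← Matrix.mul_assoc, ← hXS, Matrix.mul_assoc, ← hXS, Matrix.mul_assoc]
    have hSit : S⁻¹ᵀ * Omega n = Omega n * S := by
      rw [transpose_mul_Omega_of_mem_Sp hSi,
        nonsing_inv_nonsing_inv S ((isUnit_iff_isUnit_det S).mp (isUnit_of_mem_Sp hS))]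
    have hform : S⁻¹ᵀ * 1 * S⁻¹ = Omega n * (X * aeval (X * X) q) := by
      calc S⁻¹ᵀ * 1 * S⁻¹ = (S⁻¹ᵀ * Omega n) * Y * aeval (Y * Y) q * S⁻¹ := by
            rw [← hq]; noncomm_ring
        _ = Omega n * (S * Y) * aeval (Y * Y) q * S⁻¹ := by rw [hSit]; noncomm_ring
        _ = Omega n * X * (S * aeval (Y * Y) q) * S⁻¹ := by rw [← hXS]; noncomm_ring
        _ = Omega n * X * aeval (X * X) q * (S * S⁻¹) := by rw [hint]; noncomm_ring
        _ = Omega n * (X * aeval (X * X) q) := by rw [h2]; noncomm_ring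
    rw [← hform]
    exact PosDef.one.transpose_mul_mul (isUnit_of_mem_Sp hSi)
  · refine Or.inr ⟨S * B * S⁻¹, ?_, ?_, fun a ha => ?_⟩
    · have := conj_mem_sp hSi hB
      rwa [nonsing_inv_nonsing_inv S ((isUnit_iff_isUnit_det S).mp (isUnit_of_mem_Sp hS))] at this
    · calc X * (S * B * S⁻¹) = S * (Y * B) * S⁻¹ := by
            rw [← Matrix.mul_assoc, ← Matrix.mul_assoc, hXS]; noncomm_ring
        _ = S * B * (S⁻¹ * S) * Y * S⁻¹ := by rw [hYB, h1]; noncomm_ring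
        _ = S * B * S⁻¹ * X := by rw [hXY]; noncomm_ring
    · refine not_hasInvariantForm_smul_add hskew hBt hB0 hYB a ?_
      have := ha.conj h2
      have he : S⁻¹ * (a • X + S * B * S⁻¹) * S = a • Y + B := by
        rw [Matrix.mul_add, Matrix.add_mul, Matrix.mul_smul, smul_mul, ← hY]
        congr 1
        calc S⁻¹ * (S * B * S⁻¹) * S = (S⁻¹ * S) * B * (S⁻¹ * S) := by noncomm_ring
          _ = B := by rw [h1, Matrix.one_mul, Matrix.mul_one]
      rwa [he] at this

theorem commute_aeval_mul_self (X : Matrix (Fin n ⊕ Fin n) (Fin n ⊕ Fin n) ℝ) (q : ℝ[X]) :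
    X * aeval (X * X) q = aeval (X * X) q * X :=
  aeval_intertwine (Matrix.mul_assoc X X X).symm q

theorem transpose_Omega_mul_aeval (hX : X ∈ sp n) (q : ℝ[X]) :
    (Omega n * (X * aeval (X * X) q))ᵀ = Omega n * (X * aeval (X * X) q) := by
  have hX' := mem_sp_iff.mp hX
  have h : Omega n * aeval (X * X) q = (aeval (X * X) q)ᵀ * Omega n := by
    rw [transpose_aeval]
    refine aeval_intertwine ?_ q
    rw [transpose_mul, Matrix.mul_assoc, hX', Matrix.mul_neg, ← Matrix.mul_assoc Xᵀ, hX']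
    noncomm_ring
  calc (Omega n * (X * aeval (X * X) q))ᵀ = -((aeval (X * X) q)ᵀ * (Xᵀ * Omega n)) := by
        rw [transpose_mul, transpose_mul, Omega_transpose]; noncomm_ring
    _ = ((aeval (X * X) q)ᵀ * Omega n) * X := by rw [hX']; noncomm_ring
    _ = Omega n * (X * aeval (X * X) q) := by
      rw [← h, commute_aeval_mul_self, Matrix.mul_assoc]

theorem hasInvariantForm_of_aeval_posDef (hX : X ∈ sp n) {q : ℝ[X]}
    (hq : (Omega n * (X * aeval (X * X) q)).PosDef) : HasInvariantForm X := by
  refine ⟨_, hq, ?_⟩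
  calc Xᵀ * (Omega n * (X * aeval (X * X) q)) + Omega n * (X * aeval (X * X) q) * X
      = (Xᵀ * Omega n) * (X * aeval (X * X) q) + Omega n * X * (aeval (X * X) q * X) := by
        noncomm_ring
    _ = 0 := by rw [mem_sp_iff.mp hX, ← commute_aeval_mul_self]; noncomm_ring

theorem isCompact_centralizer_of_aeval_posDef {q : ℝ[X]}
    (hq : (Omega n * (X * aeval (X * X) q)).PosDef) :
    IsCompact {S ∈ Sp n | S * X = X * S} := by
  refine (isCompact_setOf_transpose_mul_mul_eq hq).of_isClosed_subset ?_ ?_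
  · have hc : Continuous fun S : Matrix (Fin n ⊕ Fin n) (Fin n ⊕ Fin n) ℝ => Sᵀ * Omega n * S := by
      fun_prop
    exact (isClosed_eq hc continuous_const).inter (isClosed_eq (by fun_prop) (by fun_prop))
  · rintro S ⟨hS, hSX⟩
    have hS' : Sᵀ * Omega n * S = Omega n := hS
    have hint : S * aeval (X * X) q = aeval (X * X) q * S := by
      refine aeval_intertwine ?_ q
      rw [← Matrix.mul_assoc, hSX, Matrix.mul_assoc, hSX, Matrix.mul_assoc]
    change Sᵀ * (Omega n * (X * aeval (X * X) q)) * S = _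
    calc Sᵀ * (Omega n * (X * aeval (X * X) q)) * S
        = Sᵀ * Omega n * X * (aeval (X * X) q * S) := by noncomm_ring
      _ = Sᵀ * Omega n * (X * S) * aeval (X * X) q := by rw [← hint]; noncomm_ring
      _ = (Sᵀ * Omega n * S) * X * aeval (X * X) q := by rw [← hSX]; noncomm_ring
      _ = Omega n * (X * aeval (X * X) q) := by rw [hS', Matrix.mul_assoc]

end

end Symplectic

/-- Inside `sp(2n,ℝ)` (with its subspace topology), the set `𝒟` of
strongly stable elements equals the interior of the set of stable elements, i.e. of
those elements conjugate under `Sp(2n,ℝ)` into the unitary subalgebra. -/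
theorem stronglyStable_eq_interior_stable (n : ℕ) :
    {X : (sp n) | IsCompact {S ∈ Sp n |
        S * (X : Matrix (Fin n ⊕ Fin n) (Fin n ⊕ Fin n) ℝ)
          = (X : Matrix (Fin n ⊕ Fin n) (Fin n ⊕ Fin n) ℝ) * S}} =
      interior {X : (sp n) | ∃ S ∈ Sp n,
        (S⁻¹ * (X : Matrix (Fin n ⊕ Fin n) (Fin n ⊕ Fin n) ℝ) * S) * Omega n
          = Omega n * (S⁻¹ * (X : Matrix (Fin n ⊕ Fin n) (Fin n ⊕ Fin n) ℝ) * S)} := by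
  ext ⟨X, hX⟩
  rw [mem_interior_iff_mem_nhds]
  constructor
  · intro hG
    have hstab := stable_of_hasInvariantForm hX
      (hasInvariantForm_of_isCompact_centralizer hX rfl hG)
    obtain ⟨q, hq⟩ | ⟨B, hB, hXB, hnot⟩ := exists_aeval_posDef_or_exists_commuting hX hstab
    · have hc : Continuous fun Y : sp n => Omega n * (Y.1 * Polynomial.aeval (Y.1 * Y.1) q) := by
        have : Continuous fun Y : sp n => Polynomial.aeval (Y.1 * Y.1) q :=
          q.continuous_aeval.comp (by fun_prop)
        fun_prop
      filter_upwards [eventually_posDef hc (fun Y => transpose_Omega_mul_aeval Y.2 q)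
        (x₀ := ⟨X, hX⟩) hq] with Y hY
      exact stable_of_hasInvariantForm Y.2 (hasInvariantForm_of_aeval_posDef Y.2 hY)
    · refine absurd (hasInvariantForm_of_isCompact_centralizer hB hXB hG) ?_
      simpa using hnot 0
  · intro hnhds
    have hstab := mem_of_mem_nhds hnhds
    obtain ⟨q, hq⟩ | ⟨B, hB, hXB, hnot⟩ := exists_aeval_posDef_or_exists_commuting hX hstab
    · exact isCompact_centralizer_of_aeval_posDef hq
    · exfalso
      have hmem : ∀ ε : ℝ, X + ε • B ∈ sp n := by
        intro ε
        rw [mem_sp_iff, transpose_add, transpose_smul, Matrix.add_mul, smul_mul,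
          mem_sp_iff.mp hX, mem_sp_iff.mp hB, Matrix.mul_add, Matrix.mul_smul]
        module
      have hc : Continuous fun ε : ℝ => (⟨X + ε • B, hmem ε⟩ : sp n) :=
        Continuous.subtype_mk (by fun_prop) _
      have hev := (hc.tendsto' 0 ⟨X, hX⟩ (by simp)).eventually hnhds
      obtain ⟨ε, hε, hε0⟩ :=
        ((hev.filter_mono nhdsWithin_le_nhds).and (self_mem_nhdsWithin (s := {(0 : ℝ)}ᶜ))).exists
      have hform := (hasInvariantForm_of_stable (hmem ε) hε).smul ε⁻¹
      rw [smul_add, smul_smul, inv_mul_cancel₀ hε0, one_smul] at hform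
      exact hnot ε⁻¹ hform
end
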